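/- arXiv:1205.6884 — 2 statements merged into one kernel-verified Lean document; each statement's English description precedes it below -/
import Mathlib

section
/- For the Glauber dynamics of the SOS model on Λ = {1,…,L}×{1,…,m} with m ≤ L, floor at height 0, ceiling at n⁺ and arbitrary boundary condition ξ, there exists a constant c = c(β) such that the relaxation time satisfies T_rel ≤ c·L²·m²·n⁺·exp(7β·m·n⁺). Consequently, when L = m, the mixing time satisfies T_mix = exp(O(β·L·n⁺)). -/
open scoped Classical
open Filter

noncomputable section

namespace SOSPaper

/-- Sites of the lattice `ℤ²`. -/
abbrev Site : Type := ℤ × ℤ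

/-- Height configurations on `ℤ²`. -/
abbrev Config : Type := Site → ℤ

/-- Nearest-neighbour adjacency on `ℤ²`. -/
def SiteAdj (x y : Site) : Prop := (x.1 - y.1).natAbs + (x.2 - y.2).natAbs = 1

/-- The four nearest neighbours of a site. -/
def nbrs (x : Site) : Finset Site :=
  {(x.1 + 1, x.2), (x.1 - 1, x.2), (x.1, x.2 + 1), (x.1, x.2 - 1)}

/-- The SOS Hamiltonian on `Λ` with boundary condition `ξ`:
`H_Λ^ξ(η) = (1/2) Σ_{x,y∈Λ adjacent} |η_x-η_y| + Σ_{x∈Λ, y∉Λ adjacent} |η_x-ξ_y|`. -/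
def sosH (Λ : Finset Site) (ξ : Config) (η : Config) : ℝ :=
  (1 / 2) * ∑ x ∈ Λ, ∑ y ∈ (nbrs x).filter (fun y => y ∈ Λ), ((|η x - η y| : ℤ) : ℝ)
    + ∑ x ∈ Λ, ∑ y ∈ (nbrs x).filter (fun y => y ∉ Λ), ((|η x - ξ y| : ℤ) : ℝ)

/-- Extension of `g : Λ → ℤ` by the boundary condition `ξ` off `Λ`. -/
def extendC (Λ : Finset Site) (ξ : Config) (g : {x // x ∈ Λ} → ℤ) : Config :=
  fun x => if h : x ∈ Λ then g ⟨x, h⟩ else ξ x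

/-- Gibbs weight `exp(-β·H_Λ^ξ(η) + F(η))`, subject to the single-site constraint
`η_x ∈ K` for all `x ∈ Λ` (floor/ceiling constraints); `F` is an extra external field
(`F = 0` for the plain SOS model). -/
def gWeight (β : ℝ) (Λ : Finset Site) (ξ : Config) (K : Set ℤ) (F : Config → ℝ)
    (η : Config) : ℝ :=
  if ∀ x ∈ Λ, η x ∈ K then Real.exp (-β * sosH Λ ξ η + F η) else 0

/-- The Gibbs probability of a set `A` of configurations: normalized sum of Gibbs
weights over all configurations agreeing with `ξ` off `Λ`. -/
def gProb (β : ℝ) (Λ : Finset Site) (ξ : Config) (K : Set ℤ) (F : Config → ℝ)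
    (A : Set Config) : ℝ :=
  (∑' g : {x // x ∈ Λ} → ℤ, Set.indicator A (gWeight β Λ ξ K F) (extendC Λ ξ g))
    / ∑' g : {x // x ∈ Λ} → ℤ, gWeight β Λ ξ K F (extendC Λ ξ g)

/-- The box `Λ_L = {1,…,L}²`. -/
def box (L : ℕ) : Finset Site := Finset.Icc ((1 : ℤ), (1 : ℤ)) ((L : ℤ), (L : ℤ))

/-- The equilibrium height `H(L) = ⌊log L / (4β)⌋`. -/
def eqHt (β : ℝ) (L : ℕ) : ℤ := ⌊Real.log L / (4 * β)⌋

/-- Heat-bath update probability at site `x` for new value `v`: the Gibbs conditional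
probability of the value `v` at `x` given the heights at all other sites. -/
def heatBath (β : ℝ) (Λ : Finset Site) (ξ : Config) (K : Set ℤ) (F : Config → ℝ)
    (η : Config) (x : Site) (v : ℤ) : ℝ :=
  gWeight β Λ ξ K F (Function.update η x v)
    / ∑' w : ℤ, gWeight β Λ ξ K F (Function.update η x w)

/-- One step of the Glauber (heat-bath) dynamics: pick a uniformly random site `x ∈ Λ`
and resample the height at `x` from the Gibbs conditional distribution. -/
def glauber (β : ℝ) (Λ : Finset Site) (ξ : Config) (K : Set ℤ) (F : Config → ℝ)
    (η σ : Config) : ℝ :=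
  ((Λ.card : ℝ))⁻¹ *
    ∑ x ∈ Λ, (if σ = Function.update η x (σ x) then heatBath β Λ ξ K F η x (σ x) else 0)

/-- `t`-step transition probabilities of a Markov kernel `P`. -/
def chainLaw (P : Config → Config → ℝ) : ℕ → Config → Config → ℝ
  | 0, η, σ => if σ = η then 1 else 0
  | (t + 1), η, σ => ∑' τ : Config, chainLaw P t η τ * P τ σ

/-- The law at time `t` of the chain started from `η`, evaluated on a set `A`. -/
def lawProb (P : Config → Config → ℝ) (t : ℕ) (η : Config) (A : Set Config) : ℝ :=
  ∑' σ : Config, Set.indicator A (chainLaw P t η) σ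

/-- Total variation distance between two set functions. -/
def tvDist (μ ν : Set Config → ℝ) : ℝ := ⨆ A : Set Config, |μ A - ν A|

/-- The state space of the dynamics: configurations agreeing with `ξ` off `Λ` and
obeying the constraint `K` on `Λ`. -/
def stateSpace (Λ : Finset Site) (ξ : Config) (K : Set ℤ) : Set Config :=
  {η | (∀ x ∈ Λ, η x ∈ K) ∧ ∀ x ∉ Λ, η x = ξ x}

/-- The mixing time of the Glauber dynamics: first time at which the total variation
distance to equilibrium is at most `1/(2e)`, uniformly in the initial configuration. -/
def mixingTime (β : ℝ) (Λ : Finset Site) (ξ : Config) (K : Set ℤ) (F : Config → ℝ) : ℕ :=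
  sInf {t : ℕ | 0 < t ∧ ∀ η ∈ stateSpace Λ ξ K,
    tvDist (lawProb (glauber β Λ ξ K F) t η) (gProb β Λ ξ K F) ≤ (2 * Real.exp 1)⁻¹}

/-- Expectation with respect to the Gibbs measure. -/
def gExp (β : ℝ) (Λ : Finset Site) (ξ : Config) (K : Set ℤ) (F : Config → ℝ)
    (f : Config → ℝ) : ℝ :=
  (∑' g : {x // x ∈ Λ} → ℤ, gWeight β Λ ξ K F (extendC Λ ξ g) * f (extendC Λ ξ g))
    / ∑' g : {x // x ∈ Λ} → ℤ, gWeight β Λ ξ K F (extendC Λ ξ g)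

/-- Action of a Markov kernel on a function. -/
def applyK (P : Config → Config → ℝ) (f : Config → ℝ) (η : Config) : ℝ :=
  ∑' σ : Config, P η σ * f σ

/-- The Dirichlet form `π(f(I−P)f)` of the Glauber dynamics. -/
def dirichlet (β : ℝ) (Λ : Finset Site) (ξ : Config) (K : Set ℤ) (F : Config → ℝ)
    (f : Config → ℝ) : ℝ :=
  gExp β Λ ξ K F (fun η => f η * (f η - applyK (glauber β Λ ξ K F) f η))

/-- The variance of `f` under the Gibbs measure. -/
def gVar (β : ℝ) (Λ : Finset Site) (ξ : Config) (K : Set ℤ) (F : Config → ℝ)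
    (f : Config → ℝ) : ℝ :=
  gExp β Λ ξ K F (fun η => (f η - gExp β Λ ξ K F f) ^ 2)

/-- The spectral gap of the Glauber dynamics, via the variational characterization
`gap = inf_{f non-constant} π(f(I−P)f)/Var_π(f)`. -/
def spectralGap (β : ℝ) (Λ : Finset Site) (ξ : Config) (K : Set ℤ) (F : Config → ℝ) : ℝ :=
  ⨅ f : {f : Config → ℝ //
      ¬ ∀ η ∈ stateSpace Λ ξ K, ∀ η' ∈ stateSpace Λ ξ K, f η = f η'},
    dirichlet β Λ ξ K F f.1 / gVar β Λ ξ K F f.1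

/-- The relaxation time: inverse spectral gap. -/
def relaxTime (β : ℝ) (Λ : Finset Site) (ξ : Config) (K : Set ℤ) (F : Config → ℝ) : ℝ :=
  (spectralGap β Λ ξ K F)⁻¹

/-- The trajectory determined by the initial configuration `η₀` and the sequence of
subsequent states `f`. -/
def trajOf (η₀ : Config) (f : ℕ → Config) : ℕ → Config
  | 0 => η₀
  | (t + 1) => f t

/-- The steps function obtained from finitely many steps, extended arbitrarily. -/
def extSteps (N : ℕ) (η₀ : Config) (f : Fin N → Config) : ℕ → Config :=
  fun t => if h : t < N then f ⟨t, h⟩ else η₀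

/-- The probability that the trajectory of the chain started at `η₀` satisfies the
event `E` (an event depending only on the first `N` steps). -/
def pathProb (P : Config → Config → ℝ) (η₀ : Config) (N : ℕ)
    (E : (ℕ → Config) → Prop) : ℝ :=
  ∑' f : Fin N → Config,
    if E (trajOf η₀ (extSteps N η₀ f)) then
      ∏ t ∈ Finset.range N,
        P (trajOf η₀ (extSteps N η₀ f) t) (trajOf η₀ (extSteps N η₀ f) (t + 1))
    else 0

/-- The rectangle `{1,…,L} × {1,…,m}`. -/
def rectLm (L m : ℕ) : Finset Site := Finset.Icc ((1 : ℤ), (1 : ℤ)) ((L : ℤ), (m : ℤ))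

def Om (Λ : Finset Site) (ξ : Config) (n : ℕ) : Finset Config :=
  (Fintype.piFinset (fun _ : {x // x ∈ Λ} => Finset.Icc (0:ℤ) n)).image (extendC Λ ξ)

lemma mem_Om {Λ : Finset Site} {ξ : Config} {n : ℕ} {η : Config} :
    η ∈ Om Λ ξ n ↔ (∀ x ∈ Λ, 0 ≤ η x ∧ η x ≤ n) ∧ ∀ x ∉ Λ, η x = ξ x := by
  unfold Om
  simp only [Finset.mem_image, Fintype.mem_piFinset, Finset.mem_Icc]
  constructor
  · rintro ⟨g, hg, rfl⟩
    refine ⟨fun x hx => ?_, fun x hx => ?_⟩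
    · simpa [extendC, hx] using hg ⟨x, hx⟩
    · simp [extendC, hx]
  · rintro ⟨h1, h2⟩
    refine ⟨fun x => η x.1, fun x => h1 x.1 x.2, ?_⟩
    funext x
    by_cases hx : x ∈ Λ
    · simp [extendC, hx]
    · simp [extendC, hx, h2 x hx]

lemma mem_stateSpace_iff {Λ : Finset Site} {ξ : Config} {n : ℕ} {η : Config} :
    η ∈ stateSpace Λ ξ (Set.Icc 0 (n:ℤ)) ↔ η ∈ Om Λ ξ n := by
  rw [mem_Om]; rfl

lemma extendC_inj (Λ : Finset Site) (ξ : Config) : Function.Injective (extendC Λ ξ) := by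
  intro g g' h
  funext x
  have := congrFun h x.1
  simpa [extendC, x.2] using this

lemma tsum_ext (Λ : Finset Site) (ξ : Config) (n : ℕ) (Φ : Config → ℝ)
    (h : ∀ η, ¬ (∀ x ∈ Λ, η x ∈ Set.Icc 0 (n:ℤ)) → Φ η = 0) :
    ∑' g : {x // x ∈ Λ} → ℤ, Φ (extendC Λ ξ g) = ∑ η ∈ Om Λ ξ n, Φ η := by
  unfold Om
  rw [Finset.sum_image (fun a _ b _ hab => extendC_inj Λ ξ hab)]
  apply tsum_eq_sum
  intro g hg
  apply h
  intro hc
  apply hg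
  rw [Fintype.mem_piFinset]
  intro x
  have := hc x.1 x.2
  simpa [extendC, x.2] using this

/-- The weight. -/
def W (β : ℝ) (Λ : Finset Site) (ξ : Config) (n : ℕ) : Config → ℝ :=
  gWeight β Λ ξ (Set.Icc 0 (n:ℤ)) (fun _ => 0)

lemma W_zero {β : ℝ} {Λ : Finset Site} {ξ : Config} {n : ℕ} {η : Config}
    (h : ¬ (∀ x ∈ Λ, η x ∈ Set.Icc 0 (n:ℤ))) : W β Λ ξ n η = 0 := by
  unfold W gWeight; rw [if_neg h]

lemma W_eq {β : ℝ} {Λ : Finset Site} {ξ : Config} {n : ℕ} {η : Config}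
    (h : η ∈ Om Λ ξ n) : W β Λ ξ n η = Real.exp (-β * sosH Λ ξ η) := by
  unfold W gWeight
  rw [if_pos, add_zero]
  intro x hx
  exact (mem_Om.1 h).1 x hx

lemma W_pos {β : ℝ} {Λ : Finset Site} {ξ : Config} {n : ℕ} {η : Config}
    (h : η ∈ Om Λ ξ n) : 0 < W β Λ ξ n η := by
  rw [W_eq h]; exact Real.exp_pos _

lemma Om_nonempty (Λ : Finset Site) (ξ : Config) (n : ℕ) : (Om Λ ξ n).Nonempty := by
  refine ⟨extendC Λ ξ (fun _ => 0), mem_Om.2 ⟨fun x hx => ?_, fun x hx => ?_⟩⟩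
  · simp [extendC, hx]
  · simp [extendC, hx]

def ZZ (β : ℝ) (Λ : Finset Site) (ξ : Config) (n : ℕ) : ℝ := ∑ η ∈ Om Λ ξ n, W β Λ ξ n η

lemma ZZ_pos (β : ℝ) (Λ : Finset Site) (ξ : Config) (n : ℕ) : 0 < ZZ β Λ ξ n :=
  Finset.sum_pos (fun _ h => W_pos h) (Om_nonempty _ _ _)

lemma gExp_eq (β : ℝ) (Λ : Finset Site) (ξ : Config) (n : ℕ) (f : Config → ℝ) :
    gExp β Λ ξ (Set.Icc 0 (n:ℤ)) (fun _ => 0) f =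
      (∑ η ∈ Om Λ ξ n, W β Λ ξ n η * f η) / ZZ β Λ ξ n := by
  unfold gExp ZZ
  congr 1
  · refine tsum_ext Λ ξ n (fun η => W β Λ ξ n η * f η) ?_
    intro η h; simp [W_zero h]
  · exact tsum_ext Λ ξ n (W β Λ ξ n) (fun η h => W_zero h)

lemma gProb_eq (β : ℝ) (Λ : Finset Site) (ξ : Config) (n : ℕ) (A : Set Config) :
    gProb β Λ ξ (Set.Icc 0 (n:ℤ)) (fun _ => 0) A =
      (∑ η ∈ Om Λ ξ n, W β Λ ξ n η * A.indicator 1 η) / ZZ β Λ ξ n := by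
  unfold gProb ZZ
  congr 1
  · change ∑' g : {x // x ∈ Λ} → ℤ, Set.indicator A (W β Λ ξ n) (extendC Λ ξ g) = _
    rw [tsum_ext Λ ξ n (Set.indicator A (W β Λ ξ n))]
    · refine Finset.sum_congr rfl fun η _ => ?_
      by_cases h : η ∈ A <;> simp [h]
    · intro η h
      by_cases h' : η ∈ A <;> simp [h', W_zero h]
  · exact tsum_ext Λ ξ n (W β Λ ξ n) (fun η h => W_zero h)

lemma update_mem {Λ : Finset Site} {ξ : Config} {n : ℕ} {η : Config} (h : η ∈ Om Λ ξ n)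
    {x : Site} (hx : x ∈ Λ) {v : ℤ} (hv : v ∈ Finset.Icc (0:ℤ) n) :
    Function.update η x v ∈ Om Λ ξ n := by
  rw [mem_Om] at *
  rw [Finset.mem_Icc] at hv
  refine ⟨fun y hy => ?_, fun y hy => ?_⟩
  · by_cases hxy : y = x
    · subst hxy; simpa using hv
    · simpa [Function.update_of_ne hxy] using h.1 y hy
  · have hxy : y ≠ x := fun e => hy (e ▸ hx)
    simpa [Function.update_of_ne hxy] using h.2 y hy

/-- single-site partition function -/
def zz (β : ℝ) (Λ : Finset Site) (ξ : Config) (n : ℕ) (x : Site) (η : Config) : ℝ :=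
  ∑ v ∈ Finset.Icc (0:ℤ) n, W β Λ ξ n (Function.update η x v)

/-- heat-bath probability -/
def qq (β : ℝ) (Λ : Finset Site) (ξ : Config) (n : ℕ) (x : Site) (η : Config) (v : ℤ) : ℝ :=
  W β Λ ξ n (Function.update η x v) / zz β Λ ξ n x η

lemma zz_pos {β : ℝ} {Λ : Finset Site} {ξ : Config} {n : ℕ} {η : Config} (h : η ∈ Om Λ ξ n)
    {x : Site} (hx : x ∈ Λ) : 0 < zz β Λ ξ n x η :=
  Finset.sum_pos (fun _ hv => W_pos (update_mem h hx hv)) ⟨0, by simp⟩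

lemma heatBath_eq (β : ℝ) (Λ : Finset Site) (ξ : Config) (n : ℕ) (η : Config)
    {x : Site} (hx : x ∈ Λ) (v : ℤ) :
    heatBath β Λ ξ (Set.Icc 0 (n:ℤ)) (fun _ => 0) η x v = qq β Λ ξ n x η v := by
  unfold heatBath qq zz
  congr 1
  apply tsum_eq_sum
  intro w hw
  apply W_zero
  intro h
  have := h x hx
  simp at this
  apply hw
  simpa using this

lemma zz_update (β : ℝ) (Λ : Finset Site) (ξ : Config) (n : ℕ) (x : Site) (η : Config) (v : ℤ) :
    zz β Λ ξ n x (Function.update η x v) = zz β Λ ξ n x η := by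
  unfold zz; simp

lemma qq_update (β : ℝ) (Λ : Finset Site) (ξ : Config) (n : ℕ) (x : Site) (η : Config) (v u : ℤ) :
    qq β Λ ξ n x (Function.update η x v) u = qq β Λ ξ n x η u := by
  unfold qq; rw [zz_update]; simp

lemma qq_nonneg {β : ℝ} {Λ : Finset Site} {ξ : Config} {n : ℕ} {η : Config} (h : η ∈ Om Λ ξ n)
    {x : Site} (hx : x ∈ Λ) {v : ℤ} (hv : v ∈ Finset.Icc (0:ℤ) n) : 0 ≤ qq β Λ ξ n x η v :=
  div_nonneg (W_pos (update_mem h hx hv)).le (zz_pos h hx).le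

lemma qq_sum {β : ℝ} {Λ : Finset Site} {ξ : Config} {n : ℕ} {η : Config} (h : η ∈ Om Λ ξ n)
    {x : Site} (hx : x ∈ Λ) : ∑ v ∈ Finset.Icc (0:ℤ) n, qq β Λ ξ n x η v = 1 := by
  unfold qq
  rw [← Finset.sum_div]
  exact div_self (zz_pos h hx).ne'

lemma qq_rev (β : ℝ) (Λ : Finset Site) (ξ : Config) (n : ℕ) (x : Site) (η : Config) (v : ℤ) :
    W β Λ ξ n (Function.update η x v) * qq β Λ ξ n x (Function.update η x v) (η x)
      = W β Λ ξ n η * qq β Λ ξ n x η v := by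
  rw [qq_update]
  unfold qq
  simp only [Function.update_eq_self]
  ring

lemma swap_sum {Λ : Finset Site} {ξ : Config} {n : ℕ} {x : Site} (hx : x ∈ Λ)
    (G : Config → ℤ → ℝ) :
    ∑ η ∈ Om Λ ξ n, ∑ v ∈ Finset.Icc (0:ℤ) n, G η v =
      ∑ η ∈ Om Λ ξ n, ∑ v ∈ Finset.Icc (0:ℤ) n, G (Function.update η x v) (η x) := by
  rw [← Finset.sum_product', ← Finset.sum_product']
  refine Finset.sum_bij' (fun p _ => (Function.update p.1 x p.2, p.1 x))
    (fun p _ => (Function.update p.1 x p.2, p.1 x)) ?_ ?_ ?_ ?_ ?_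
  · rintro ⟨η, v⟩ h
    rw [Finset.mem_product] at *
    exact ⟨update_mem h.1 hx h.2, Finset.mem_Icc.2 ((mem_Om.1 h.1).1 x hx)⟩
  · rintro ⟨η, v⟩ h
    rw [Finset.mem_product] at *
    exact ⟨update_mem h.1 hx h.2, Finset.mem_Icc.2 ((mem_Om.1 h.1).1 x hx)⟩
  · rintro ⟨η, v⟩ h; simp
  · rintro ⟨η, v⟩ h; simp
  · rintro ⟨η, v⟩ h; simp

/-- single site conditional expectation -/
def EE (β : ℝ) (Λ : Finset Site) (ξ : Config) (n : ℕ) (x : Site) (f : Config → ℝ) (η : Config) : ℝ :=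
  ∑ v ∈ Finset.Icc (0:ℤ) n, qq β Λ ξ n x η v * f (Function.update η x v)

lemma EE_adj (β : ℝ) {Λ : Finset Site} (ξ : Config) (n : ℕ) {x : Site} (hx : x ∈ Λ)
    (f g : Config → ℝ) :
    ∑ η ∈ Om Λ ξ n, W β Λ ξ n η * (g η * EE β Λ ξ n x f η) =
    ∑ η ∈ Om Λ ξ n, W β Λ ξ n η * (EE β Λ ξ n x g η * f η) := by
  have h1 : ∀ η, W β Λ ξ n η * (g η * EE β Λ ξ n x f η) = ∑ v ∈ Finset.Icc (0:ℤ) n,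
      W β Λ ξ n η * qq β Λ ξ n x η v * (g η * f (Function.update η x v)) := by
    intro η; unfold EE; rw [Finset.mul_sum, Finset.mul_sum]
    exact Finset.sum_congr rfl fun v _ => by ring
  simp_rw [h1]
  rw [swap_sum hx]
  refine Finset.sum_congr rfl fun η _ => ?_
  unfold EE
  rw [Finset.sum_mul, Finset.mul_sum]
  refine Finset.sum_congr rfl fun v _ => ?_
  rw [qq_rev]
  simp only [Function.update_idem, Function.update_eq_self]
  ring

lemma EE_update (β : ℝ) (Λ : Finset Site) (ξ : Config) (n : ℕ) (x : Site)
    (f : Config → ℝ) (η : Config) (v : ℤ) :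
    EE β Λ ξ n x f (Function.update η x v) = EE β Λ ξ n x f η := by
  unfold EE; simp [qq_update]

lemma EE_idem (β : ℝ) {Λ : Finset Site} (ξ : Config) (n : ℕ) {x : Site} (hx : x ∈ Λ)
    (f : Config → ℝ) {η : Config} (h : η ∈ Om Λ ξ n) :
    EE β Λ ξ n x (EE β Λ ξ n x f) η = EE β Λ ξ n x f η := by
  change ∑ v ∈ Finset.Icc (0:ℤ) n, qq β Λ ξ n x η v *
    EE β Λ ξ n x f (Function.update η x v) = _
  simp_rw [EE_update β Λ ξ n x f η]
  rw [← Finset.sum_mul, qq_sum h hx, one_mul]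

lemma EE_proj (β : ℝ) {Λ : Finset Site} (ξ : Config) (n : ℕ) {x : Site} (hx : x ∈ Λ)
    (f : Config → ℝ) :
    ∑ η ∈ Om Λ ξ n, W β Λ ξ n η * (EE β Λ ξ n x f η) ^ 2 =
    ∑ η ∈ Om Λ ξ n, W β Λ ξ n η * (f η * EE β Λ ξ n x f η) := by
  have := EE_adj β ξ n hx (EE β Λ ξ n x f) f
  rw [Finset.sum_congr rfl fun η h => by rw [EE_idem β ξ n hx f h]] at this
  rw [this]
  exact Finset.sum_congr rfl fun η _ => by ring

lemma EE_one (β : ℝ) {Λ : Finset Site} (ξ : Config) (n : ℕ) {x : Site} (hx : x ∈ Λ)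
    (a : ℝ) {η : Config} (h : η ∈ Om Λ ξ n) :
    EE β Λ ξ n x (fun _ => a) η = a := by
  unfold EE; rw [← Finset.sum_mul, qq_sum h hx, one_mul]

/-- local Dirichlet form -/
lemma EE_dir (β : ℝ) {Λ : Finset Site} (ξ : Config) (n : ℕ) {x : Site} (hx : x ∈ Λ)
    (f : Config → ℝ) :
    ∑ η ∈ Om Λ ξ n, W β Λ ξ n η * ∑ v ∈ Finset.Icc (0:ℤ) n, qq β Λ ξ n x η v *
        (f η - f (Function.update η x v)) ^ 2 =
    2 * ∑ η ∈ Om Λ ξ n, W β Λ ξ n η * (f η * (f η - EE β Λ ξ n x f η)) := by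
  have h1 : ∀ η ∈ Om Λ ξ n, W β Λ ξ n η * ∑ v ∈ Finset.Icc (0:ℤ) n, qq β Λ ξ n x η v *
        (f η - f (Function.update η x v)) ^ 2 =
      W β Λ ξ n η * f η ^ 2 - 2 * (W β Λ ξ n η * (f η * EE β Λ ξ n x f η)) +
      W β Λ ξ n η * (1 * EE β Λ ξ n x (fun η => f η ^ 2) η) := by
    intro η h
    have e : ∑ v ∈ Finset.Icc (0:ℤ) n, qq β Λ ξ n x η v *
        (f η - f (Function.update η x v)) ^ 2 =
        (∑ v ∈ Finset.Icc (0:ℤ) n, qq β Λ ξ n x η v) * f η ^ 2 - 2 * f η * EE β Λ ξ n x f η +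
        EE β Λ ξ n x (fun η => f η ^ 2) η := by
      unfold EE
      rw [Finset.sum_mul, Finset.mul_sum, ← Finset.sum_sub_distrib, ← Finset.sum_add_distrib]
      exact Finset.sum_congr rfl fun v _ => by ring
    rw [e, qq_sum h hx]; ring
  have h2 : ∑ η ∈ Om Λ ξ n, W β Λ ξ n η * (1 * EE β Λ ξ n x (fun η => f η ^ 2) η) =
      ∑ η ∈ Om Λ ξ n, W β Λ ξ n η * f η ^ 2 := by
    rw [EE_adj β ξ n hx _ (fun _ => 1)]
    exact Finset.sum_congr rfl fun η h => by rw [EE_one β ξ n hx 1 h, one_mul]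
  rw [Finset.sum_congr rfl h1, Finset.sum_add_distrib, h2, Finset.mul_sum,
    ← Finset.sum_add_distrib]
  exact Finset.sum_congr rfl fun η _ => by ring

/-- the transition operator -/
def PP (β : ℝ) (Λ : Finset Site) (ξ : Config) (n : ℕ) (f : Config → ℝ) (η : Config) : ℝ :=
  ((Λ.card : ℝ))⁻¹ * ∑ x ∈ Λ, EE β Λ ξ n x f η

lemma glauber_zero {β : ℝ} {Λ : Finset Site} {ξ : Config} {n : ℕ} {η σ : Config}
    (h : η ∈ Om Λ ξ n) (hσ : σ ∉ Om Λ ξ n) :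
    glauber β Λ ξ (Set.Icc 0 (n:ℤ)) (fun _ => 0) η σ = 0 := by
  unfold glauber
  rw [Finset.sum_eq_zero, mul_zero]
  intro x hx
  split_ifs with e
  · rw [heatBath_eq β Λ ξ n η hx]
    unfold qq
    rw [W_zero, zero_div]
    intro hc
    apply hσ
    rw [e]
    refine update_mem h hx ?_
    simpa using hc x hx
  · rfl

lemma glauber_sum {β : ℝ} {Λ : Finset Site} {ξ : Config} {n : ℕ} {η : Config}
    (h : η ∈ Om Λ ξ n) (f : Config → ℝ) :
    ∑ σ ∈ Om Λ ξ n, glauber β Λ ξ (Set.Icc 0 (n:ℤ)) (fun _ => 0) η σ * f σ = PP β Λ ξ n f η := by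
  unfold glauber PP
  simp_rw [mul_assoc, ← Finset.mul_sum, Finset.sum_mul]
  rw [Finset.sum_comm]
  congr 1
  refine Finset.sum_congr rfl fun x hx => ?_
  unfold EE
  simp_rw [ite_mul, zero_mul]
  rw [← Finset.sum_filter]
  symm
  refine Finset.sum_bij' (fun v _ => Function.update η x v) (fun σ _ => σ x) ?_ ?_ ?_ ?_ ?_
  · intro v hv
    rw [Finset.mem_filter]
    exact ⟨update_mem h hx hv, by simp⟩
  · intro σ hσ
    rw [Finset.mem_filter] at hσ
    exact Finset.mem_Icc.2 ((mem_Om.1 hσ.1).1 x hx)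
  · intro v hv; simp
  · intro σ hσ
    rw [Finset.mem_filter] at hσ
    exact hσ.2.symm
  · intro v hv
    rw [heatBath_eq β Λ ξ n η hx]; simp

lemma applyK_eq {β : ℝ} {Λ : Finset Site} {ξ : Config} {n : ℕ} {η : Config}
    (h : η ∈ Om Λ ξ n) (f : Config → ℝ) :
    applyK (glauber β Λ ξ (Set.Icc 0 (n:ℤ)) (fun _ => 0)) f η = PP β Λ ξ n f η := by
  rw [← glauber_sum h]
  unfold applyK
  apply tsum_eq_sum
  intro σ hσ
  rw [glauber_zero h hσ, zero_mul]

lemma dirichlet_eq (β : ℝ) (Λ : Finset Site) (ξ : Config) (n : ℕ) (f : Config → ℝ) :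
    dirichlet β Λ ξ (Set.Icc 0 (n:ℤ)) (fun _ => 0) f =
      (∑ η ∈ Om Λ ξ n, W β Λ ξ n η * (f η * (f η - PP β Λ ξ n f η))) / ZZ β Λ ξ n := by
  unfold dirichlet
  rw [gExp_eq]
  congr 1
  refine Finset.sum_congr rfl fun η h => ?_
  rw [applyK_eq h]

lemma chainLaw_zero {β : ℝ} {Λ : Finset Site} {ξ : Config} {n : ℕ} {η : Config}
    (h : η ∈ Om Λ ξ n) (t : ℕ) : ∀ σ, σ ∉ Om Λ ξ n →
    chainLaw (glauber β Λ ξ (Set.Icc 0 (n:ℤ)) (fun _ => 0)) t η σ = 0 := by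
  induction t with
  | zero =>
    intro σ hσ
    unfold chainLaw
    rw [if_neg]
    rintro rfl
    exact hσ h
  | succ t ih =>
    intro σ hσ
    unfold chainLaw
    refine (tsum_congr fun τ => ?_).trans tsum_zero
    by_cases hτ : τ ∈ Om Λ ξ n
    · rw [glauber_zero hτ hσ, mul_zero]
    · rw [ih τ hτ, zero_mul]

lemma chainLaw_sum {β : ℝ} {Λ : Finset Site} {ξ : Config} {n : ℕ} {η : Config}
    (h : η ∈ Om Λ ξ n) (t : ℕ) : ∀ f : Config → ℝ,
    ∑ σ ∈ Om Λ ξ n, chainLaw (glauber β Λ ξ (Set.Icc 0 (n:ℤ)) (fun _ => 0)) t η σ * f σ =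
      ((PP β Λ ξ n)^[t] f) η := by
  induction t with
  | zero =>
    intro f
    simp [chainLaw, h]
  | succ t ih =>
    intro f
    rw [Function.iterate_succ_apply, ← ih]
    have e : ∀ σ, chainLaw (glauber β Λ ξ (Set.Icc 0 (n:ℤ)) (fun _ => 0)) (t+1) η σ =
        ∑ τ ∈ Om Λ ξ n, chainLaw (glauber β Λ ξ (Set.Icc 0 (n:ℤ)) (fun _ => 0)) t η τ *
          glauber β Λ ξ (Set.Icc 0 (n:ℤ)) (fun _ => 0) τ σ := by
      intro σ
      conv_lhs => unfold chainLaw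
      apply tsum_eq_sum
      intro τ hτ
      rw [chainLaw_zero h t τ hτ, zero_mul]
    simp_rw [e, Finset.sum_mul]
    rw [Finset.sum_comm]
    refine Finset.sum_congr rfl fun τ hτ => ?_
    rw [← glauber_sum hτ, Finset.mul_sum]
    exact Finset.sum_congr rfl fun σ _ => by ring

lemma lawProb_eq {β : ℝ} {Λ : Finset Site} {ξ : Config} {n : ℕ} {η : Config}
    (h : η ∈ Om Λ ξ n) (t : ℕ) (A : Set Config) :
    lawProb (glauber β Λ ξ (Set.Icc 0 (n:ℤ)) (fun _ => 0)) t η A =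
      ((PP β Λ ξ n)^[t] (A.indicator 1)) η := by
  rw [← chainLaw_sum h]
  unfold lawProb
  rw [tsum_eq_sum (s := Om Λ ξ n)]
  · refine Finset.sum_congr rfl fun σ _ => ?_
    by_cases hA : σ ∈ A <;> simp [hA]
  · intro σ hσ
    by_cases hA : σ ∈ A <;> simp [hA, chainLaw_zero h t σ hσ]

lemma nbrs_sum (x : Site) (F : Site → ℝ) :
    ∑ y ∈ nbrs x, F y = F (x.1 + 1, x.2) + F (x.1 - 1, x.2) + F (x.1, x.2 + 1) + F (x.1, x.2 - 1) := by
  unfold nbrs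
  rw [Finset.sum_insert, Finset.sum_insert, Finset.sum_insert, Finset.sum_singleton]
  · ring
  · simp; omega
  · simp
  · simp; omega

lemma nbrs_symm {x y : Site} (h : y ∈ nbrs x) : x ∈ nbrs y := by
  obtain ⟨a, b⟩ := x
  obtain ⟨c, d⟩ := y
  simp only [nbrs, Finset.mem_insert, Finset.mem_singleton, Prod.mk.injEq] at *
  omega

lemma nbrs_comm (Λ : Finset Site) (F : Site → Site → ℝ) :
    ∑ x ∈ Λ, ∑ y ∈ (nbrs x).filter (fun y => y ∈ Λ), F x y =
      ∑ x ∈ Λ, ∑ y ∈ (nbrs x).filter (fun y => y ∈ Λ), F y x := by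
  apply Finset.sum_comm'
  intro x y
  simp only [Finset.mem_filter]
  constructor
  · rintro ⟨h1, h2, h3⟩; exact ⟨⟨nbrs_symm h2, h1⟩, h3⟩
  · rintro ⟨⟨h1, h2⟩, h3⟩; exact ⟨h2, nbrs_symm h1, h3⟩

lemma sosH_lip (Λ : Finset Site) (ξ a b : Config) :
    sosH Λ ξ a - sosH Λ ξ b ≤ 4 * ∑ x ∈ Λ, ((|a x - b x| : ℤ) : ℝ) := by
  have h1 : ∑ x ∈ Λ, ∑ y ∈ (nbrs x).filter (fun y => y ∈ Λ), ((|a x - a y| : ℤ) : ℝ) ≤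
      ∑ x ∈ Λ, ∑ y ∈ (nbrs x).filter (fun y => y ∈ Λ), ((|b x - b y| : ℤ) : ℝ) +
      (∑ x ∈ Λ, ∑ y ∈ (nbrs x).filter (fun y => y ∈ Λ), ((|a x - b x| : ℤ) : ℝ) +
      ∑ x ∈ Λ, ∑ y ∈ (nbrs x).filter (fun y => y ∈ Λ), ((|a y - b y| : ℤ) : ℝ)) := by
    simp_rw [← Finset.sum_add_distrib]
    refine Finset.sum_le_sum fun x _ => Finset.sum_le_sum fun y _ => ?_
    norm_cast
    grind
  rw [← nbrs_comm Λ (fun x y => ((|a x - b x| : ℤ) : ℝ))] at h1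
  have h2 : ∑ x ∈ Λ, ∑ y ∈ (nbrs x).filter (fun y => y ∉ Λ), ((|a x - ξ y| : ℤ) : ℝ) ≤
      ∑ x ∈ Λ, ∑ y ∈ (nbrs x).filter (fun y => y ∉ Λ), ((|b x - ξ y| : ℤ) : ℝ) +
      ∑ x ∈ Λ, ∑ y ∈ (nbrs x).filter (fun y => y ∉ Λ), ((|a x - b x| : ℤ) : ℝ) := by
    simp_rw [← Finset.sum_add_distrib]
    refine Finset.sum_le_sum fun x _ => Finset.sum_le_sum fun y _ => ?_
    norm_cast
    grind
  have h3 : ∑ x ∈ Λ, ∑ y ∈ (nbrs x).filter (fun y => y ∈ Λ), ((|a x - b x| : ℤ) : ℝ) +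
      ∑ x ∈ Λ, ∑ y ∈ (nbrs x).filter (fun y => y ∉ Λ), ((|a x - b x| : ℤ) : ℝ) =
      4 * ∑ x ∈ Λ, ((|a x - b x| : ℤ) : ℝ) := by
    rw [← Finset.sum_add_distrib, Finset.mul_sum]
    refine Finset.sum_congr rfl fun x _ => ?_
    rw [Finset.sum_filter_add_sum_filter_not, nbrs_sum]
    ring
  unfold sosH
  linarith

def rk (m : ℕ) (x : Site) : ℤ := (x.1 - 1) * m + (x.2 - 1)

def st (m : ℕ) (k : ℤ) : Site := (k / m + 1, k % m + 1)

lemma mem_rect {L m : ℕ} {x : Site} :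
    x ∈ rectLm L m ↔ (1 ≤ x.1 ∧ x.1 ≤ L) ∧ (1 ≤ x.2 ∧ x.2 ≤ m) := by
  unfold rectLm
  rw [Finset.mem_Icc, Prod.le_def, Prod.le_def]
  simp only
  tauto

lemma st_rk {L m : ℕ} {x : Site} (hx : x ∈ rectLm L m) : st m (rk m x) = x := by
  obtain ⟨a, b⟩ := x
  rw [mem_rect] at hx
  simp only at hx
  have hm : (m : ℤ) ≠ 0 := by omega
  unfold st rk
  simp only
  rw [Int.add_comm ((a - 1) * (m:ℤ)), Int.add_mul_ediv_right _ _ hm, Int.add_mul_emod_self_right,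
    Int.ediv_eq_zero_of_lt (by omega) (by omega), Int.emod_eq_of_lt (by omega) (by omega)]
  ext <;> simp

lemma rk_st {m : ℕ} (k : ℤ) : rk m (st m k) = k := by
  unfold st rk
  simp only
  have := Int.mul_ediv_add_emod k m
  linarith

lemma st_mem {L m : ℕ} (hm : 0 < m) {k : ℤ} (h0 : 0 ≤ k) (h1 : k < L * m) :
    st m k ∈ rectLm L m := by
  have hm' : (0:ℤ) < m := by exact_mod_cast hm
  rw [mem_rect]
  unfold st
  have a1 := Int.ediv_nonneg h0 hm'.le
  have a2 := Int.ediv_lt_of_lt_mul hm' h1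
  have a3 := Int.emod_nonneg k hm'.ne'
  have a4 := Int.emod_lt_of_pos k hm'
  simp only
  omega

lemma rk_range {L m : ℕ} {x : Site} (hx : x ∈ rectLm L m) : 0 ≤ rk m x ∧ rk m x < L * m := by
  rw [mem_rect] at hx
  unfold rk
  constructor
  · have : 0 ≤ (x.1 - 1) * (m:ℤ) := mul_nonneg (by omega) (by omega)
    omega
  · have : (x.1 - 1) * (m:ℤ) ≤ (L - 1) * m := mul_le_mul_of_nonneg_right (by omega) (by omega)
    linarith [hx.2.2]

lemma rk_inj {L m : ℕ} {x y : Site} (hx : x ∈ rectLm L m) (hy : y ∈ rectLm L m)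
    (h : rk m x = rk m y) : x = y := by
  rw [← st_rk hx, ← st_rk hy, h]

def cutI (m : ℕ) (k : ℤ) (x y : Site) : ℝ := if rk m x < k ∧ k ≤ rk m y then 1 else 0

lemma cut_count {L m : ℕ} (hm : 0 < m) (k : ℤ) :
    ∑ x ∈ rectLm L m, ∑ y ∈ (nbrs x).filter (fun y => y ∈ rectLm L m), cutI m k x y ≤
      2 * m - 1 := by
  have hp : ∀ x ∈ rectLm L m,
      ∑ y ∈ (nbrs x).filter (fun y => y ∈ rectLm L m), cutI m k x y ≤
      (if k - m ≤ rk m x ∧ rk m x < k then (1:ℝ) else 0) +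
      (if x.2 + 1 ≤ m ∧ rk m x = k - 1 then (1:ℝ) else 0) := by
    intro x hx
    rw [Finset.sum_filter, nbrs_sum]
    have e1 : rk m (x.1 + 1, x.2) = rk m x + m := by unfold rk; ring
    have e2 : rk m (x.1 - 1, x.2) = rk m x - m := by unfold rk; ring
    have e3 : rk m (x.1, x.2 + 1) = rk m x + 1 := by unfold rk; ring
    have e4 : rk m (x.1, x.2 - 1) = rk m x - 1 := by unfold rk; ring
    unfold cutI
    rw [e1, e2, e3, e4]
    have b2 : (if ((x.1 - 1, x.2) : Site) ∈ rectLm L m then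
      (if rk m x < k ∧ k ≤ rk m x - m then (1:ℝ) else 0) else 0) = 0 := by
      rw [if_neg (c := _ ∧ _) (by omega)]; simp
    have b4 : (if ((x.1, x.2 - 1) : Site) ∈ rectLm L m then
      (if rk m x < k ∧ k ≤ rk m x - 1 then (1:ℝ) else 0) else 0) = 0 := by
      rw [if_neg (c := _ ∧ _) (by omega)]; simp
    rw [b2, b4]
    have b1 : (if ((x.1 + 1, x.2) : Site) ∈ rectLm L m then
      (if rk m x < k ∧ k ≤ rk m x + m then (1:ℝ) else 0) else 0) ≤
      (if k - m ≤ rk m x ∧ rk m x < k then (1:ℝ) else 0) := by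
      split_ifs <;> first | (exfalso; omega) | norm_num
    have b3 : (if ((x.1, x.2 + 1) : Site) ∈ rectLm L m then
      (if rk m x < k ∧ k ≤ rk m x + 1 then (1:ℝ) else 0) else 0) ≤
      (if x.2 + 1 ≤ m ∧ rk m x = k - 1 then (1:ℝ) else 0) := by
      by_cases hmem : ((x.1, x.2 + 1) : Site) ∈ rectLm L m
      · have h5 : x.2 + 1 ≤ (m:ℤ) := (mem_rect.1 hmem).2.2
        rw [if_pos hmem]
        split_ifs <;> first | (exfalso; omega) | norm_num
      · rw [if_neg hmem]
        split_ifs <;> norm_num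
    linarith
  refine (Finset.sum_le_sum hp).trans ?_
  rw [Finset.sum_add_distrib, Finset.sum_boole, Finset.sum_boole]
  have c1 : ((rectLm L m).filter (fun x => k - m ≤ rk m x ∧ rk m x < k)).card ≤ m := by
    calc _ ≤ (Finset.Ico (k - m) k).card := by
          apply Finset.card_le_card_of_injOn (rk m)
          · intro x hx
            simp at hx
            simp; omega
          · intro x hx y hy h
            simp at hx hy
            exact rk_inj hx.1 hy.1 h
      _ = m := by simp
  have c2 : ((rectLm L m).filter (fun x : Site => x.2 + 1 ≤ (m:ℤ) ∧ rk m x = k - 1)).card ≤ m - 1 := by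
    calc _ ≤ (Finset.Icc (1:ℤ) (m - 1)).card := by
          apply Finset.card_le_card_of_injOn (fun x : Site => x.2)
          · intro x hx
            simp [mem_rect] at hx
            simp; omega
          · intro x hx y hy h
            simp at hx hy
            exact rk_inj hx.1 hy.1 (hx.2.2.trans hy.2.2.symm)
      _ = m - 1 := by simp
  have c2' : (((rectLm L m).filter (fun x : Site => x.2 + 1 ≤ (m:ℤ) ∧ rk m x = k - 1)).card : ℝ) ≤ m - 1 := by
    have c3 := Nat.add_le_of_le_sub hm c2
    have c4 : (((rectLm L m).filter (fun x : Site => x.2 + 1 ≤ (m:ℤ) ∧ rk m x = k - 1)).card : ℝ)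
      + 1 ≤ m := by exact_mod_cast c3
    linarith
  have c1' : (((rectLm L m).filter (fun x => k - m ≤ rk m x ∧ rk m x < k)).card : ℝ) ≤ m := by
    exact_mod_cast c1
  linarith

def mix (m : ℕ) (k : ℤ) (η η' : Config) : Config := fun y => if rk m y < k then η' y else η y

lemma mix_mix (m : ℕ) (k : ℤ) (η η' : Config) : mix m k (mix m k η η') (mix m k η' η) = η := by
  funext y; unfold mix; split_ifs <;> rfl

lemma mix_mem {Λ : Finset Site} {ξ : Config} {n : ℕ} {η η' : Config} (m : ℕ) (k : ℤ)
    (h : η ∈ Om Λ ξ n) (h' : η' ∈ Om Λ ξ n) : mix m k η η' ∈ Om Λ ξ n := by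
  rw [mem_Om] at *
  unfold mix
  refine ⟨fun x hx => ?_, fun x hx => ?_⟩
  · split_ifs
    · exact h'.1 x hx
    · exact h.1 x hx
  · split_ifs
    · exact h'.2 x hx
    · exact h.2 x hx

lemma sosH_mix {L m : ℕ} (hm : 0 < m) (k : ℤ) {ξ : Config} {n : ℕ} {η η' : Config}
    (h : η ∈ Om (rectLm L m) ξ n) (h' : η' ∈ Om (rectLm L m) ξ n) :
    sosH (rectLm L m) ξ (mix m k η η') + sosH (rectLm L m) ξ (mix m k η' η) ≤
      sosH (rectLm L m) ξ η + sosH (rectLm L m) ξ η' + (4 * m - 2) * n := by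
  set Λ := rectLm L m
  have h1 : ∑ x ∈ Λ, ∑ y ∈ (nbrs x).filter (fun y => y ∈ Λ),
        ((|mix m k η η' x - mix m k η η' y| : ℤ) : ℝ) +
      ∑ x ∈ Λ, ∑ y ∈ (nbrs x).filter (fun y => y ∈ Λ),
        ((|mix m k η' η x - mix m k η' η y| : ℤ) : ℝ) ≤
      ∑ x ∈ Λ, ∑ y ∈ (nbrs x).filter (fun y => y ∈ Λ), ((|η x - η y| : ℤ) : ℝ) +
      ∑ x ∈ Λ, ∑ y ∈ (nbrs x).filter (fun y => y ∈ Λ), ((|η' x - η' y| : ℤ) : ℝ) +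
      2 * n * (∑ x ∈ Λ, ∑ y ∈ (nbrs x).filter (fun y => y ∈ Λ), cutI m k x y +
      ∑ x ∈ Λ, ∑ y ∈ (nbrs x).filter (fun y => y ∈ Λ), cutI m k y x) := by
    simp_rw [← Finset.sum_add_distrib, Finset.mul_sum, ← Finset.sum_add_distrib]
    refine Finset.sum_le_sum fun x hx => Finset.sum_le_sum fun y hy => ?_
    have hy := (Finset.mem_filter.1 hy).2
    have i1 := (mem_Om.1 h).1 x hx
    have i2 := (mem_Om.1 h).1 y hy
    have i3 := (mem_Om.1 h').1 x hx
    have i4 := (mem_Om.1 h').1 y hy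
    have j1 : ∀ a b : ℤ, 0 ≤ a ∧ a ≤ n → 0 ≤ b ∧ b ≤ n → ((|a - b| : ℤ) : ℝ) ≤ n := by
      intro a b ha hb
      have : |a - b| ≤ (n:ℤ) := by rw [abs_le]; constructor <;> omega
      exact_mod_cast this
    have j2 : ∀ a b : ℤ, (0:ℝ) ≤ ((|a - b| : ℤ) : ℝ) := by
      intro a b; exact_mod_cast abs_nonneg _
    have k1 := j1 _ _ i1 i4
    have k2 := j1 _ _ i3 i2
    have k3 := j2 (η x) (η y)
    have k4 := j2 (η' x) (η' y)
    unfold mix cutI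
    by_cases hx' : rk m x < k <;> by_cases hy' : rk m y < k
    · simp [hx', hy', not_le.2 hx', not_le.2 hy', add_comm]
    · simp only [hx', hy', not_lt.1 hy', not_le.2 hx', if_true, if_false, and_self]
      linarith
    · simp only [hx', hy', not_lt.1 hx', not_le.2 hy', if_true, if_false, and_self]
      linarith
    · simp [hx', hy']
  rw [← nbrs_comm Λ (cutI m k)] at h1
  have h2 : ∑ x ∈ Λ, ∑ y ∈ (nbrs x).filter (fun y => y ∉ Λ),
        ((|mix m k η η' x - ξ y| : ℤ) : ℝ) +
      ∑ x ∈ Λ, ∑ y ∈ (nbrs x).filter (fun y => y ∉ Λ),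
        ((|mix m k η' η x - ξ y| : ℤ) : ℝ) =
      ∑ x ∈ Λ, ∑ y ∈ (nbrs x).filter (fun y => y ∉ Λ), ((|η x - ξ y| : ℤ) : ℝ) +
      ∑ x ∈ Λ, ∑ y ∈ (nbrs x).filter (fun y => y ∉ Λ), ((|η' x - ξ y| : ℤ) : ℝ) := by
    simp_rw [← Finset.sum_add_distrib]
    refine Finset.sum_congr rfl fun x hx => Finset.sum_congr rfl fun y hy => ?_
    unfold mix
    split_ifs
    · ring
    · rfl
  have h3 := mul_le_mul_of_nonneg_left (cut_count (L := L) hm k) (Nat.cast_nonneg (α := ℝ) n)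
  unfold sosH
  linarith

lemma W_mix {β : ℝ} (hβ : 0 < β) {L m : ℕ} (hm : 0 < m) (k : ℤ) {ξ : Config} {n : ℕ} {η η' : Config}
    (h : η ∈ Om (rectLm L m) ξ n) (h' : η' ∈ Om (rectLm L m) ξ n) :
    W β (rectLm L m) ξ n η * W β (rectLm L m) ξ n η' ≤
      Real.exp (β * ((4 * m - 2) * n)) *
      (W β (rectLm L m) ξ n (mix m k η η') * W β (rectLm L m) ξ n (mix m k η' η)) := by
  rw [W_eq h, W_eq h', W_eq (mix_mem m k h h'), W_eq (mix_mem m k h' h), ← Real.exp_add,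
    ← Real.exp_add, ← Real.exp_add, Real.exp_le_exp]
  have := mul_le_mul_of_nonneg_left (sosH_mix hm k h h') hβ.le
  linarith

lemma W_ratio {β : ℝ} (hβ : 0 < β) {Λ : Finset Site} {ξ : Config} {n : ℕ} {η η' : Config}
    (h : η ∈ Om Λ ξ n) (h' : η' ∈ Om Λ ξ n) (B : ℝ)
    (hB : ∑ x ∈ Λ, ((|η' x - η x| : ℤ) : ℝ) ≤ B) :
    W β Λ ξ n η ≤ Real.exp (4 * β * B) * W β Λ ξ n η' := by
  rw [W_eq h, W_eq h', ← Real.exp_add, Real.exp_le_exp]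
  have h1 := sosH_lip Λ ξ η' η
  have := mul_le_mul_of_nonneg_left (h1.trans (mul_le_mul_of_nonneg_left hB (by norm_num))) hβ.le
  linarith

lemma diff_le {Λ : Finset Site} {ξ : Config} {n : ℕ} {η η' : Config}
    (h : η ∈ Om Λ ξ n) (h' : η' ∈ Om Λ ξ n) {x : Site} (hx : x ∈ Λ) :
    ((|η' x - η x| : ℤ) : ℝ) ≤ n := by
  have ha := (mem_Om.1 h).1 x hx
  have hb := (mem_Om.1 h').1 x hx
  have : |η' x - η x| ≤ (n:ℤ) := by rw [abs_le]; constructor <;> omega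
  exact_mod_cast this

lemma qq_lower {β : ℝ} (hβ : 0 < β) {Λ : Finset Site} {ξ : Config} {n : ℕ} {η : Config}
    (h : η ∈ Om Λ ξ n) {x : Site} (hx : x ∈ Λ) {v : ℤ} (hv : v ∈ Finset.Icc (0:ℤ) n) :
    1 ≤ ((n + 1 : ℝ) * Real.exp (4 * β * n)) * qq β Λ ξ n x η v := by
  have hz : zz β Λ ξ n x η ≤
      ((n + 1 : ℝ) * Real.exp (4 * β * n)) * W β Λ ξ n (Function.update η x v) := by
    unfold zz
    calc _ ≤ ∑ u ∈ Finset.Icc (0:ℤ) n,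
          Real.exp (4 * β * n) * W β Λ ξ n (Function.update η x v) := by
          refine Finset.sum_le_sum fun u hu => ?_
          refine W_ratio hβ (update_mem h hx hu) (update_mem h hx hv) _ ?_
          rw [Finset.sum_eq_single_of_mem x hx]
          · exact diff_le (update_mem h hx hu) (update_mem h hx hv) hx
          · intro y _ hy
            simp [Function.update_of_ne hy]
      _ = _ := by
          rw [Finset.sum_const, Int.card_Icc, nsmul_eq_mul]
          have : (((n:ℤ) + 1 - 0).toNat : ℝ) = n + 1 := by
            have : ((n:ℤ) + 1 - 0).toNat = n + 1 := by omega
            rw [this]; push_cast; rfl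
          rw [this]; ring
  unfold qq
  rw [← mul_div_assoc, one_le_div (zz_pos h hx)]
  exact hz

lemma mix_succ {L m : ℕ} {ξ : Config} {n : ℕ} {k : ℤ} {η η' : Config}
    (h : η ∈ Om (rectLm L m) ξ n) (h' : η' ∈ Om (rectLm L m) ξ n) :
    mix m (k+1) η η' = Function.update (mix m k η η') (st m k) (mix m k η' η (st m k)) := by
  funext y
  by_cases hy : y = st m k
  · subst hy
    simp [mix, rk_st]
  · rw [Function.update_of_ne hy]
    unfold mix
    by_cases hyΛ : y ∈ rectLm L m
    · have : rk m y ≠ k := by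
        intro e; apply hy; rw [← e, st_rk hyΛ]
      by_cases hk : rk m y < k
      · rw [if_pos hk, if_pos (by omega)]
      · rw [if_neg hk, if_neg (by omega)]
    · rw [(mem_Om.1 h).2 y hyΛ, (mem_Om.1 h').2 y hyΛ]; simp

lemma mix_zero {L m : ℕ} {ξ : Config} {n : ℕ} {η η' : Config}
    (h : η ∈ Om (rectLm L m) ξ n) (h' : η' ∈ Om (rectLm L m) ξ n) :
    mix m 0 η η' = η := by
  funext y
  unfold mix
  by_cases hyΛ : y ∈ rectLm L m
  · rw [if_neg (not_lt.2 (rk_range hyΛ).1)]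
  · rw [(mem_Om.1 h).2 y hyΛ, (mem_Om.1 h').2 y hyΛ]; simp

lemma mix_last {L m : ℕ} {ξ : Config} {n : ℕ} {η η' : Config}
    (h : η ∈ Om (rectLm L m) ξ n) (h' : η' ∈ Om (rectLm L m) ξ n) :
    mix m (L * m) η η' = η' := by
  funext y
  unfold mix
  by_cases hyΛ : y ∈ rectLm L m
  · rw [if_pos (rk_range hyΛ).2]
  · rw [(mem_Om.1 h).2 y hyΛ, (mem_Om.1 h').2 y hyΛ]; simp

lemma pair_swap {Λ : Finset Site} {ξ : Config} {n : ℕ} (m : ℕ) (k : ℤ)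
    (G : Config → Config → ℝ) :
    ∑ η ∈ Om Λ ξ n, ∑ η' ∈ Om Λ ξ n, G (mix m k η η') (mix m k η' η) =
    ∑ η ∈ Om Λ ξ n, ∑ η' ∈ Om Λ ξ n, G η η' := by
  rw [← Finset.sum_product', ← Finset.sum_product']
  refine Finset.sum_bij' (fun p _ => (mix m k p.1 p.2, mix m k p.2 p.1))
    (fun p _ => (mix m k p.1 p.2, mix m k p.2 p.1)) ?_ ?_ ?_ ?_ ?_
  · rintro ⟨η, v⟩ h
    rw [Finset.mem_product] at *
    exact ⟨mix_mem m k h.1 h.2, mix_mem m k h.2 h.1⟩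
  · rintro ⟨η, v⟩ h
    rw [Finset.mem_product] at *
    exact ⟨mix_mem m k h.1 h.2, mix_mem m k h.2 h.1⟩
  · rintro ⟨η, v⟩ h; simp [mix_mix]
  · rintro ⟨η, v⟩ h; simp [mix_mix]
  · rintro ⟨η, v⟩ h; simp

/-- one step of the path -/
lemma path_step {β : ℝ} (hβ : 0 < β) {L m : ℕ} (hm : 0 < m) (ξ : Config) (n : ℕ) {k : ℤ}
    (h0 : 0 ≤ k) (h1 : k < L * m) (f : Config → ℝ) :
    ∑ η ∈ Om (rectLm L m) ξ n, ∑ η' ∈ Om (rectLm L m) ξ n,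
      W β (rectLm L m) ξ n η * W β (rectLm L m) ξ n η' *
        (f (mix m (k+1) η η') - f (mix m k η η')) ^ 2 ≤
    Real.exp (β * ((4 * m - 2) * n)) * ((n + 1 : ℝ) * Real.exp (4 * β * n)) *
      ZZ β (rectLm L m) ξ n * (2 * ∑ η ∈ Om (rectLm L m) ξ n, W β (rectLm L m) ξ n η *
        (f η * (f η - EE β (rectLm L m) ξ n (st m k) f η))) := by
  have hx := st_mem hm h0 h1
  set Λ := rectLm L m
  set x := st m k
  set C1 := Real.exp (β * ((4 * m - 2) * n)) with hC1
  set C2 := (n + 1 : ℝ) * Real.exp (4 * β * n) with hC2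
  have hC2p : 0 ≤ C2 := by positivity
  set S : Config → ℝ := fun σ => ∑ v ∈ Finset.Icc (0:ℤ) n, qq β Λ ξ n x σ v *
        (f σ - f (Function.update σ x v)) ^ 2 with hS
  have key : ∀ σ ∈ Om Λ ξ n, ∀ v ∈ Finset.Icc (0:ℤ) n,
      (f (Function.update σ x v) - f σ) ^ 2 ≤ C2 * S σ := by
    intro σ hσ v hv
    have a1 : qq β Λ ξ n x σ v * (f σ - f (Function.update σ x v)) ^ 2 ≤ S σ :=
      Finset.single_le_sum (f := fun v => qq β Λ ξ n x σ v *
        (f σ - f (Function.update σ x v)) ^ 2)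
        (fun u hu => mul_nonneg (qq_nonneg hσ hx hu) (sq_nonneg _)) hv
    have a2 := mul_le_mul_of_nonneg_right (qq_lower hβ hσ hx hv)
      (sq_nonneg (f (Function.update σ x v) - f σ))
    have a3 := mul_le_mul_of_nonneg_left a1 hC2p
    rw [one_mul] at a2
    refine a2.trans ?_
    calc _ = C2 * (qq β Λ ξ n x σ v * (f σ - f (Function.update σ x v)) ^ 2) := by ring
      _ ≤ _ := a3
  calc _ ≤ ∑ η ∈ Om Λ ξ n, ∑ η' ∈ Om Λ ξ n,
        C1 * (W β Λ ξ n (mix m k η η') * W β Λ ξ n (mix m k η' η)) *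
          (f (Function.update (mix m k η η') x (mix m k η' η x)) - f (mix m k η η')) ^ 2 := by
        refine Finset.sum_le_sum fun η h => Finset.sum_le_sum fun η' h' => ?_
        rw [mix_succ h h']
        exact mul_le_mul_of_nonneg_right (W_mix hβ hm k h h') (sq_nonneg _)
    _ = ∑ σ ∈ Om Λ ξ n, ∑ σ' ∈ Om Λ ξ n, C1 * (W β Λ ξ n σ * W β Λ ξ n σ') *
          (f (Function.update σ x (σ' x)) - f σ) ^ 2 :=
        pair_swap m k (fun σ σ' => C1 * (W β Λ ξ n σ * W β Λ ξ n σ') *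
          (f (Function.update σ x (σ' x)) - f σ) ^ 2)
    _ ≤ ∑ σ ∈ Om Λ ξ n, ∑ σ' ∈ Om Λ ξ n, C1 * (W β Λ ξ n σ * W β Λ ξ n σ') * (C2 * S σ) := by
        refine Finset.sum_le_sum fun σ h => Finset.sum_le_sum fun σ' h' => ?_
        refine mul_le_mul_of_nonneg_left (key σ h _ ?_) ?_
        · exact Finset.mem_Icc.2 ((mem_Om.1 h').1 x hx)
        · exact mul_nonneg (Real.exp_pos _).le (mul_nonneg (W_pos h).le (W_pos h').le)
    _ = C1 * C2 * ZZ β Λ ξ n * ∑ σ ∈ Om Λ ξ n, W β Λ ξ n σ * S σ := by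
        unfold ZZ
        rw [Finset.mul_sum, Finset.mul_sum]
        simp_rw [Finset.sum_mul]
        refine Finset.sum_congr rfl fun σ _ => Finset.sum_congr rfl fun σ' _ => ?_
        ring
    _ = _ := by rw [hS, EE_dir β ξ n hx f]

lemma var_expand (β : ℝ) (Λ : Finset Site) (ξ : Config) (n : ℕ) (f : Config → ℝ) :
    ∑ η ∈ Om Λ ξ n, ∑ η' ∈ Om Λ ξ n, W β Λ ξ n η * W β Λ ξ n η' * (f η' - f η) ^ 2 =
      2 * (ZZ β Λ ξ n * ∑ η ∈ Om Λ ξ n, W β Λ ξ n η * f η ^ 2 -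
        (∑ η ∈ Om Λ ξ n, W β Λ ξ n η * f η) ^ 2) := by
  have e : ∀ η η', W β Λ ξ n η * W β Λ ξ n η' * (f η' - f η) ^ 2 =
     W β Λ ξ n η * (W β Λ ξ n η' * f η' ^ 2) + (W β Λ ξ n η * f η ^ 2) * W β Λ ξ n η' -
       2 * ((W β Λ ξ n η * f η) * (W β Λ ξ n η' * f η')) := by
    intro η η'; ring
  simp_rw [e, Finset.sum_sub_distrib, Finset.sum_add_distrib, ← Finset.mul_sum, ← Finset.sum_mul]
  unfold ZZ
  ring

lemma gVar_eq (β : ℝ) (Λ : Finset Site) (ξ : Config) (n : ℕ) (f : Config → ℝ) :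
    gVar β Λ ξ (Set.Icc 0 (n:ℤ)) (fun _ => 0) f =
      (∑ η ∈ Om Λ ξ n, W β Λ ξ n η * f η ^ 2) / ZZ β Λ ξ n -
        ((∑ η ∈ Om Λ ξ n, W β Λ ξ n η * f η) / ZZ β Λ ξ n) ^ 2 := by
  unfold gVar
  rw [gExp_eq, gExp_eq]
  set a := (∑ η ∈ Om Λ ξ n, W β Λ ξ n η * f η) / ZZ β Λ ξ n with ha
  have e : ∑ η ∈ Om Λ ξ n, W β Λ ξ n η * (f η - a) ^ 2 =
    ∑ η ∈ Om Λ ξ n, W β Λ ξ n η * f η ^ 2 - 2 * a * ∑ η ∈ Om Λ ξ n, W β Λ ξ n η * f η +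
      a ^ 2 * ZZ β Λ ξ n := by
    unfold ZZ
    rw [Finset.mul_sum, Finset.mul_sum, ← Finset.sum_sub_distrib, ← Finset.sum_add_distrib]
    exact Finset.sum_congr rfl fun η _ => by ring
  have hz := (ZZ_pos β Λ ξ n).ne'
  have e2 : ∑ η ∈ Om Λ ξ n, W β Λ ξ n η * f η = a * ZZ β Λ ξ n := by
    rw [ha]; field_simp
  rw [e, e2]
  field_simp
  ring

lemma card_rect (L m : ℕ) : (rectLm L m).card = L * m := by
  unfold rectLm
  rw [← Finset.Icc_product_Icc]
  simp

lemma sum_range_st {L m : ℕ} (hm : 0 < m) (F : Site → ℝ) :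
    ∑ k ∈ Finset.range (L * m), F (st m k) = ∑ x ∈ rectLm L m, F x := by
  refine Finset.sum_bij' (fun k _ => st m k) (fun x _ => (rk m x).toNat) ?_ ?_ ?_ ?_ ?_
  · intro k hk
    exact st_mem hm (by positivity) (by exact_mod_cast Finset.mem_range.1 hk)
  · intro x hx
    have := rk_range hx
    rw [Finset.mem_range]
    zify
    rw [Int.toNat_of_nonneg this.1]
    exact this.2
  · intro k hk; simp [rk_st]
  · intro x hx
    rw [Int.toNat_of_nonneg (rk_range hx).1, st_rk hx]
  · intro k hk; rfl

def CC (β : ℝ) (L m n : ℕ) : ℝ := ((L * m : ℕ) : ℝ) ^ 2 *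
  (Real.exp (β * ((4 * m - 2) * n)) * ((n + 1 : ℝ) * Real.exp (4 * β * n)))

lemma sum_PP (β : ℝ) (Λ : Finset Site) (ξ : Config) (n : ℕ) (f : Config → ℝ)
    (hN : (Λ.card : ℝ) ≠ 0) :
    ∑ x ∈ Λ, ∑ η ∈ Om Λ ξ n, W β Λ ξ n η * (f η * (f η - EE β Λ ξ n x f η)) =
      Λ.card * ∑ η ∈ Om Λ ξ n, W β Λ ξ n η * (f η * (f η - PP β Λ ξ n f η)) := by
  rw [Finset.sum_comm, Finset.mul_sum]
  refine Finset.sum_congr rfl fun η _ => ?_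
  rw [← Finset.mul_sum, ← Finset.mul_sum, Finset.sum_sub_distrib, Finset.sum_const, nsmul_eq_mul]
  unfold PP
  field_simp

lemma path_all (β : ℝ) {L m : ℕ} (ξ : Config) (n : ℕ) (f : Config → ℝ) :
    ∑ η ∈ Om (rectLm L m) ξ n, ∑ η' ∈ Om (rectLm L m) ξ n,
      W β (rectLm L m) ξ n η * W β (rectLm L m) ξ n η' * (f η' - f η) ^ 2 ≤
      ((L * m : ℕ) : ℝ) * ∑ k ∈ Finset.range (L * m),
        ∑ η ∈ Om (rectLm L m) ξ n, ∑ η' ∈ Om (rectLm L m) ξ n,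
      W β (rectLm L m) ξ n η * W β (rectLm L m) ξ n η' *
        (f (mix m ((k:ℤ)+1) η η') - f (mix m k η η')) ^ 2 := by
  rw [Finset.sum_comm (s := Finset.range (L * m)), Finset.mul_sum]
  refine Finset.sum_le_sum fun η h => ?_
  rw [Finset.sum_comm (s := Finset.range (L * m)), Finset.mul_sum]
  refine Finset.sum_le_sum fun η' h' => ?_
  rw [← Finset.mul_sum, mul_left_comm]
  refine mul_le_mul_of_nonneg_left ?_ (mul_nonneg (W_pos h).le (W_pos h').le)
  have t := Finset.sum_range_sub (fun k : ℕ => f (mix m (k:ℤ) η η')) (L * m)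
  have t0 : mix m ((0:ℕ):ℤ) η η' = η := by
    rw [Nat.cast_zero]; exact mix_zero h h'
  have t1 : mix m ((L * m : ℕ):ℤ) η η' = η' := by
    rw [Nat.cast_mul]; exact mix_last h h'
  rw [t0, t1] at t
  rw [← t]
  have := sq_sum_le_card_mul_sum_sq (s := Finset.range (L * m))
    (f := fun k : ℕ => f (mix m ((k+1 : ℕ):ℤ) η η') - f (mix m (k:ℤ) η η'))
  rw [Finset.card_range] at this
  simpa only [Nat.cast_add, Nat.cast_one] using this

lemma step_all {β : ℝ} (hβ : 0 < β) {L m : ℕ} (hL : 0 < L) (hm : 0 < m) (ξ : Config) (n : ℕ)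
    (f : Config → ℝ) :
    ∑ k ∈ Finset.range (L * m), ∑ η ∈ Om (rectLm L m) ξ n, ∑ η' ∈ Om (rectLm L m) ξ n,
      W β (rectLm L m) ξ n η * W β (rectLm L m) ξ n η' *
        (f (mix m ((k:ℤ)+1) η η') - f (mix m k η η')) ^ 2 ≤
      Real.exp (β * ((4 * m - 2) * n)) * ((n + 1 : ℝ) * Real.exp (4 * β * n)) *
        ZZ β (rectLm L m) ξ n * (2 * (((L * m : ℕ) : ℝ) *
       ∑ η ∈ Om (rectLm L m) ξ n, W β (rectLm L m) ξ n η *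
        (f η * (f η - PP β (rectLm L m) ξ n f η)))) := by
  have hN : (((rectLm L m).card : ℕ) : ℝ) ≠ 0 := by
    rw [card_rect]; exact_mod_cast (Nat.mul_pos hL hm).ne'
  have h2 := sum_PP β (rectLm L m) ξ n f hN
  rw [card_rect] at h2
  rw [← h2, ← sum_range_st hm (fun x => ∑ η ∈ Om (rectLm L m) ξ n, W β (rectLm L m) ξ n η *
        (f η * (f η - EE β (rectLm L m) ξ n x f η))), Finset.mul_sum, Finset.mul_sum]
  refine Finset.sum_le_sum fun k hk => ?_
  refine path_step hβ hm ξ n (by positivity) ?_ f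
  exact_mod_cast Finset.mem_range.1 hk

lemma poinc_arith {A B D Z N C S T : ℝ} (hZ : 0 < Z) (hN : 0 < N) (h1 : S = 2 * (Z * A - B ^ 2))
    (h2 : S ≤ N * T) (h3 : T ≤ C * Z * (2 * (N * D))) :
    A / Z - (B / Z) ^ 2 ≤ (N ^ 2 * C) * (D / Z) := by
  have h4 := h2.trans (mul_le_mul_of_nonneg_left h3 hN.le)
  have e1 : A / Z - (B / Z) ^ 2 = (Z * A - B ^ 2) / Z ^ 2 := by field_simp
  have e2 : (N ^ 2 * C) * (D / Z) = (N ^ 2 * C * Z * D) / Z ^ 2 := by field_simp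
  rw [e1, e2]
  apply div_le_div_of_nonneg_right _ (by positivity)
  linarith

lemma poincare {β : ℝ} (hβ : 0 < β) {L m : ℕ} (hL : 0 < L) (hm : 0 < m) (ξ : Config) (n : ℕ)
    (f : Config → ℝ) :
    gVar β (rectLm L m) ξ (Set.Icc 0 (n:ℤ)) (fun _ => 0) f ≤
      CC β L m n * dirichlet β (rectLm L m) ξ (Set.Icc 0 (n:ℤ)) (fun _ => 0) f := by
  rw [gVar_eq, dirichlet_eq]
  unfold CC
  have hN : (0:ℝ) < ((L * m : ℕ) : ℝ) := by exact_mod_cast Nat.mul_pos hL hm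
  exact poinc_arith (ZZ_pos β (rectLm L m) ξ n) hN (var_expand β (rectLm L m) ξ n f)
    (path_all β ξ n f) (step_all hβ hL hm ξ n f)

lemma gExp_PP {β : ℝ} {Λ : Finset Site} (hN : Λ.Nonempty) (ξ : Config) (n : ℕ) (f : Config → ℝ) :
    ∑ η ∈ Om Λ ξ n, W β Λ ξ n η * PP β Λ ξ n f η = ∑ η ∈ Om Λ ξ n, W β Λ ξ n η * f η := by
  have hc : (Λ.card : ℝ) ≠ 0 := by exact_mod_cast hN.card_pos.ne'
  unfold PP
  have e : ∀ η, W β Λ ξ n η * ((Λ.card : ℝ)⁻¹ * ∑ x ∈ Λ, EE β Λ ξ n x f η) =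
      (Λ.card : ℝ)⁻¹ * ∑ x ∈ Λ, W β Λ ξ n η * (1 * EE β Λ ξ n x f η) := by
    intro η; rw [← Finset.mul_sum]; simp only [one_mul]; ring
  simp_rw [e]
  rw [← Finset.mul_sum, Finset.sum_comm]
  have h1 : ∀ x ∈ Λ, ∑ η ∈ Om Λ ξ n, W β Λ ξ n η * (1 * EE β Λ ξ n x f η) =
      ∑ η ∈ Om Λ ξ n, W β Λ ξ n η * f η := by
    intro x hx
    rw [EE_adj β ξ n hx f (fun _ => 1)]
    exact Finset.sum_congr rfl fun η h => by rw [EE_one β ξ n hx 1 h, one_mul]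
  rw [Finset.sum_congr rfl h1, Finset.sum_const, nsmul_eq_mul]
  field_simp

lemma norm_PP {β : ℝ} {Λ : Finset Site} (hN : Λ.Nonempty) (ξ : Config) (n : ℕ) (f : Config → ℝ) :
    ∑ η ∈ Om Λ ξ n, W β Λ ξ n η * PP β Λ ξ n f η ^ 2 ≤
      ∑ η ∈ Om Λ ξ n, W β Λ ξ n η * (f η * PP β Λ ξ n f η) := by
  have hc : (0:ℝ) < Λ.card := by exact_mod_cast hN.card_pos
  have h1 : ∀ η, PP β Λ ξ n f η ^ 2 ≤ (Λ.card : ℝ)⁻¹ * ∑ x ∈ Λ, EE β Λ ξ n x f η ^ 2 := by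
    intro η
    unfold PP
    have := sq_sum_le_card_mul_sum_sq (s := Λ) (f := fun x => EE β Λ ξ n x f η)
    have h2 := mul_le_mul_of_nonneg_left this (by positivity : (0:ℝ) ≤ ((Λ.card:ℝ)⁻¹) ^ 2)
    rw [mul_pow]
    refine h2.trans (le_of_eq ?_)
    field_simp
  calc _ ≤ ∑ η ∈ Om Λ ξ n, W β Λ ξ n η * ((Λ.card : ℝ)⁻¹ * ∑ x ∈ Λ, EE β Λ ξ n x f η ^ 2) :=
        Finset.sum_le_sum fun η h => mul_le_mul_of_nonneg_left (h1 η) (W_pos h).le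
    _ = (Λ.card : ℝ)⁻¹ * ∑ x ∈ Λ, ∑ η ∈ Om Λ ξ n, W β Λ ξ n η * EE β Λ ξ n x f η ^ 2 := by
        rw [Finset.sum_comm, Finset.mul_sum]
        refine Finset.sum_congr rfl fun η _ => ?_
        rw [← Finset.mul_sum]; ring
    _ = (Λ.card : ℝ)⁻¹ * ∑ x ∈ Λ, ∑ η ∈ Om Λ ξ n, W β Λ ξ n η * (f η * EE β Λ ξ n x f η) := by
        congr 1
        exact Finset.sum_congr rfl fun x hx => EE_proj β ξ n hx f
    _ = _ := by
        rw [Finset.sum_comm, Finset.mul_sum]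
        refine Finset.sum_congr rfl fun η _ => ?_
        unfold PP
        rw [← Finset.mul_sum, ← Finset.mul_sum]; ring

lemma gVar_PP {β : ℝ} {Λ : Finset Site} (hN : Λ.Nonempty) (ξ : Config) (n : ℕ) (f : Config → ℝ) :
    gVar β Λ ξ (Set.Icc 0 (n:ℤ)) (fun _ => 0) (PP β Λ ξ n f) ≤
      gVar β Λ ξ (Set.Icc 0 (n:ℤ)) (fun _ => 0) f -
        dirichlet β Λ ξ (Set.Icc 0 (n:ℤ)) (fun _ => 0) f := by
  rw [gVar_eq, gVar_eq, dirichlet_eq, gExp_PP hN]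
  have hz := ZZ_pos β Λ ξ n
  have h1 := div_le_div_of_nonneg_right (norm_PP (β := β) hN ξ n f) hz.le
  have e : ∑ η ∈ Om Λ ξ n, W β Λ ξ n η * (f η * (f η - PP β Λ ξ n f η)) =
      ∑ η ∈ Om Λ ξ n, W β Λ ξ n η * f η ^ 2 -
      ∑ η ∈ Om Λ ξ n, W β Λ ξ n η * (f η * PP β Λ ξ n f η) := by
    rw [← Finset.sum_sub_distrib]
    exact Finset.sum_congr rfl fun η _ => by ring
  rw [e, sub_div]
  linarith

lemma point_le (β : ℝ) {Λ : Finset Site} (ξ : Config) (n : ℕ) (f : Config → ℝ) {η : Config}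
    (h : η ∈ Om Λ ξ n) :
    W β Λ ξ n η / ZZ β Λ ξ n * (f η - gExp β Λ ξ (Set.Icc 0 (n:ℤ)) (fun _ => 0) f) ^ 2 ≤
      gVar β Λ ξ (Set.Icc 0 (n:ℤ)) (fun _ => 0) f := by
  unfold gVar
  set a := gExp β Λ ξ (Set.Icc 0 (n:ℤ)) (fun _ => 0) f
  rw [gExp_eq, div_mul_eq_mul_div]
  refine div_le_div_of_nonneg_right ?_ (ZZ_pos β Λ ξ n).le
  exact Finset.single_le_sum (f := fun η => W β Λ ξ n η * (f η - a) ^ 2)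
    (fun σ hσ => mul_nonneg (W_pos hσ).le (sq_nonneg _)) h

lemma gVar_nonneg (β : ℝ) (Λ : Finset Site) (ξ : Config) (n : ℕ) (f : Config → ℝ) :
    0 ≤ gVar β Λ ξ (Set.Icc 0 (n:ℤ)) (fun _ => 0) f := by
  obtain ⟨η, h⟩ := Om_nonempty Λ ξ n
  refine le_trans ?_ (point_le β ξ n f h)
  exact mul_nonneg (div_nonneg (W_pos h).le (ZZ_pos β Λ ξ n).le) (sq_nonneg _)

lemma CC_pos (β : ℝ) {L m : ℕ} (hL : 0 < L) (hm : 0 < m) (n : ℕ) : 0 < CC β L m n := by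
  unfold CC
  have : (0:ℝ) < ((L * m : ℕ) : ℝ) := by exact_mod_cast Nat.mul_pos hL hm
  positivity

lemma rect_nonempty {L m : ℕ} (hL : 0 < L) (hm : 0 < m) : (rectLm L m).Nonempty :=
  ⟨(1, 1), mem_rect.2 (by simp only; omega)⟩

lemma gVar_iter {β : ℝ} (hβ : 0 < β) {L m : ℕ} (hL : 0 < L) (hm : 0 < m) (ξ : Config) (n : ℕ)
    (t : ℕ) : ∀ f : Config → ℝ,
    gVar β (rectLm L m) ξ (Set.Icc 0 (n:ℤ)) (fun _ => 0) ((PP β (rectLm L m) ξ n)^[t] f) ≤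
      Real.exp (-(t / CC β L m n)) * gVar β (rectLm L m) ξ (Set.Icc 0 (n:ℤ)) (fun _ => 0) f := by
  have hC := CC_pos β hL hm n
  induction t with
  | zero => intro f; simp
  | succ t ih =>
    intro f
    rw [Function.iterate_succ_apply]
    refine (ih _).trans ?_
    have h1 := gVar_PP (β := β) (rect_nonempty hL hm) ξ n f
    have h2 := poincare hβ hL hm ξ n f
    have h0 := gVar_nonneg β (rectLm L m) ξ n f
    have h3 : gVar β (rectLm L m) ξ (Set.Icc 0 (n:ℤ)) (fun _ => 0) (PP β (rectLm L m) ξ n f) ≤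
        Real.exp (-(1 / CC β L m n)) *
          gVar β (rectLm L m) ξ (Set.Icc 0 (n:ℤ)) (fun _ => 0) f := by
      have h4 : 1 / CC β L m n * gVar β (rectLm L m) ξ (Set.Icc 0 (n:ℤ)) (fun _ => 0) f ≤
          dirichlet β (rectLm L m) ξ (Set.Icc 0 (n:ℤ)) (fun _ => 0) f := by
        rw [one_div_mul_eq_div, div_le_iff₀ hC, mul_comm]; exact h2
      have h5 := Real.add_one_le_exp (-(1 / CC β L m n))
      have h6 := mul_le_mul_of_nonneg_right h5 h0
      linarith
    refine (mul_le_mul_of_nonneg_left h3 (Real.exp_pos _).le).trans (le_of_eq ?_)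
    rw [← mul_assoc, ← Real.exp_add]
    congr 2
    push_cast
    ring

lemma gExp_iter {β : ℝ} {Λ : Finset Site} (hN : Λ.Nonempty) (ξ : Config) (n : ℕ) (t : ℕ) :
    ∀ f : Config → ℝ, gExp β Λ ξ (Set.Icc 0 (n:ℤ)) (fun _ => 0) ((PP β Λ ξ n)^[t] f) =
      gExp β Λ ξ (Set.Icc 0 (n:ℤ)) (fun _ => 0) f := by
  induction t with
  | zero => intro f; rfl
  | succ t ih =>
    intro f
    rw [Function.iterate_succ_apply, ih, gExp_eq, gExp_eq, gExp_PP hN]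

lemma gVar_ind (β : ℝ) (Λ : Finset Site) (ξ : Config) (n : ℕ) (A : Set Config) :
    gVar β Λ ξ (Set.Icc 0 (n:ℤ)) (fun _ => 0) (A.indicator 1) ≤ 1 := by
  rw [gVar_eq]
  have hz := ZZ_pos β Λ ξ n
  have : (∑ η ∈ Om Λ ξ n, W β Λ ξ n η * (A.indicator 1 η : ℝ) ^ 2) / ZZ β Λ ξ n ≤ 1 := by
    rw [div_le_one hz]
    refine Finset.sum_le_sum fun η h => ?_
    have := W_pos (β := β) h
    by_cases hA : η ∈ A <;> simp [hA, this.le]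
  linarith [sq_nonneg ((∑ η ∈ Om Λ ξ n, W β Λ ξ n η * (A.indicator 1 η : ℝ)) / ZZ β Λ ξ n)]

lemma pimin {β : ℝ} (hβ : 0 < β) {Λ : Finset Site} {ξ : Config} {n : ℕ} {η : Config}
    (h : η ∈ Om Λ ξ n) :
    ZZ β Λ ξ n ≤ Real.exp ((4 * β + 1) * (Λ.card * n)) * W β Λ ξ n η := by
  have h1 : ∀ σ ∈ Om Λ ξ n, W β Λ ξ n σ ≤ Real.exp (4 * β * (Λ.card * n)) * W β Λ ξ n η := by
    intro σ hσ
    refine W_ratio hβ hσ h _ ?_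
    refine (Finset.sum_le_sum fun x hx => diff_le hσ h hx).trans ?_
    simp
  have h2 : ((Om Λ ξ n).card : ℝ) ≤ Real.exp (Λ.card * n) := by
    have a : (Om Λ ξ n).card ≤ (n + 1) ^ Λ.card := by
      refine Finset.card_image_le.trans ?_
      rw [Fintype.card_piFinset]
      simp
    have b : ((Om Λ ξ n).card : ℝ) ≤ ((n:ℝ) + 1) ^ Λ.card := by exact_mod_cast a
    refine b.trans ?_
    rw [Real.exp_nat_mul]
    exact pow_le_pow_left₀ (by positivity) (Real.add_one_le_exp _) _
  have hw := W_pos (β := β) h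
  calc ZZ β Λ ξ n ≤ ∑ σ ∈ Om Λ ξ n, Real.exp (4 * β * (Λ.card * n)) * W β Λ ξ n η :=
        Finset.sum_le_sum h1
    _ = (Om Λ ξ n).card * (Real.exp (4 * β * (Λ.card * n)) * W β Λ ξ n η) := by
        rw [Finset.sum_const, nsmul_eq_mul]
    _ ≤ Real.exp (Λ.card * n) * (Real.exp (4 * β * (Λ.card * n)) * W β Λ ξ n η) :=
        mul_le_mul_of_nonneg_right h2 (by positivity)
    _ = _ := by
        rw [← mul_assoc, ← Real.exp_add]; congr 2; ring

lemma gProb_gExp (β : ℝ) (Λ : Finset Site) (ξ : Config) (n : ℕ) (A : Set Config) :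
    gProb β Λ ξ (Set.Icc 0 (n:ℤ)) (fun _ => 0) A =
      gExp β Λ ξ (Set.Icc 0 (n:ℤ)) (fun _ => 0) (A.indicator 1) := by
  rw [gProb_eq, gExp_eq]

lemma tv_bound {β : ℝ} (hβ : 0 < β) {L m : ℕ} (hL : 0 < L) (hm : 0 < m) (ξ : Config) (n : ℕ)
    {η : Config} (h : η ∈ Om (rectLm L m) ξ n) (t : ℕ)
    (ht : CC β L m n * ((4 * β + 1) * ((L * m : ℕ) * n) + 4) ≤ t) :
    tvDist (lawProb (glauber β (rectLm L m) ξ (Set.Icc 0 (n:ℤ)) (fun _ => 0)) t η)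
      (gProb β (rectLm L m) ξ (Set.Icc 0 (n:ℤ)) (fun _ => 0)) ≤ (2 * Real.exp 1)⁻¹ := by
  unfold tvDist
  refine ciSup_le fun A => ?_
  rw [lawProb_eq h, gProb_gExp, ← gExp_iter (rect_nonempty hL hm) ξ n t]
  have h1 := point_le β ξ n ((PP β (rectLm L m) ξ n)^[t] (A.indicator 1)) h
  have h2 := gVar_iter hβ hL hm ξ n t (A.indicator 1)
  have h3 := mul_le_mul_of_nonneg_left (gVar_ind β (rectLm L m) ξ n A)
    (Real.exp_pos (-(t / CC β L m n))).le
  have h4 := (h1.trans h2).trans h3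
  set d := ((PP β (rectLm L m) ξ n)^[t] (A.indicator 1)) η -
    gExp β (rectLm L m) ξ (Set.Icc 0 (n:ℤ)) (fun _ => 0)
      ((PP β (rectLm L m) ξ n)^[t] (A.indicator 1))
  have hz := ZZ_pos β (rectLm L m) ξ n
  have hw := W_pos (β := β) h
  have hC := CC_pos β hL hm n
  have h5 := pimin hβ h
  rw [card_rect] at h5
  set R := (4 * β + 1) * (((L * m : ℕ) : ℝ) * n)
  have h6 : d ^ 2 ≤ Real.exp R * Real.exp (-(t / CC β L m n)) := by
    have h7 : Real.exp (-R) ≤ W β (rectLm L m) ξ n η / ZZ β (rectLm L m) ξ n := by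
      rw [le_div_iff₀ hz, Real.exp_neg, inv_mul_le_iff₀ (Real.exp_pos _)]
      exact h5
    have h8 := (mul_le_mul_of_nonneg_right h7 (sq_nonneg d)).trans h4
    rw [Real.exp_neg, inv_mul_le_iff₀ (Real.exp_pos _), mul_one] at h8
    exact h8
  rw [← Real.exp_add] at h6
  have h9 : R + 4 ≤ t / CC β L m n := by
    rw [le_div_iff₀ hC, mul_comm]; exact ht
  have h10 : d ^ 2 ≤ (Real.exp (-2)) ^ 2 := by
    refine h6.trans ?_
    rw [← Real.exp_nat_mul, Real.exp_le_exp]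
    push_cast
    linarith
  have h11 : |d| ≤ Real.exp (-2) := abs_le_of_sq_le_sq h10 (Real.exp_pos _).le
  refine h11.trans ?_
  rw [Real.exp_neg]
  apply inv_anti₀ (by positivity)
  have : Real.exp 2 = Real.exp 1 * Real.exp 1 := by rw [← Real.exp_add]; norm_num
  rw [this]
  have := Real.add_one_le_exp (1:ℝ)
  exact mul_le_mul_of_nonneg_right (by linarith) (Real.exp_pos _).le

lemma mix_le {β : ℝ} (hβ : 0 < β) {L m : ℕ} (hL : 0 < L) (hm : 0 < m) (ξ : Config) (n : ℕ) :
    (mixingTime β (rectLm L m) ξ (Set.Icc 0 (n:ℤ)) (fun _ => 0) : ℝ) ≤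
      CC β L m n * ((4 * β + 1) * ((L * m : ℕ) * n) + 4) + 1 := by
  have hC := CC_pos β hL hm n
  set X := CC β L m n * ((4 * β + 1) * ((L * m : ℕ) * n) + 4) with hX
  have hXp : 0 < X := by positivity
  have h1 : mixingTime β (rectLm L m) ξ (Set.Icc 0 (n:ℤ)) (fun _ => 0) ≤ ⌈X⌉₊ := by
    apply Nat.sInf_le
    refine ⟨Nat.ceil_pos.2 hXp, fun η hη => ?_⟩
    exact tv_bound hβ hL hm ξ n (mem_stateSpace_iff.1 hη) _ (Nat.le_ceil _)
  have h2 := Nat.ceil_lt_add_one hXp.le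
  have h3 : (mixingTime β (rectLm L m) ξ (Set.Icc 0 (n:ℤ)) (fun _ => 0) : ℝ) ≤ ⌈X⌉₊ := by
    exact_mod_cast h1
  linarith

lemma Om_single {Λ : Finset Site} {ξ : Config} {η σ : Config}
    (h : η ∈ Om Λ ξ 0) (h' : σ ∈ Om Λ ξ 0) : σ = η := by
  rw [mem_Om] at *
  funext x
  by_cases hx : x ∈ Λ
  · have := h.1 x hx
    have := h'.1 x hx
    push_cast at *
    omega
  · rw [h.2 x hx, h'.2 x hx]

lemma mix_n_zero (β : ℝ) {L m : ℕ} (hL : 0 < L) (hm : 0 < m) (ξ : Config) :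
    mixingTime β (rectLm L m) ξ (Set.Icc 0 ((0:ℕ):ℤ)) (fun _ => 0) ≤ 1 := by
  apply Nat.sInf_le
  refine ⟨one_pos, fun η hη => ?_⟩
  have h := mem_stateSpace_iff.1 hη
  have hs : Om (rectLm L m) ξ 0 = {η} := by
    ext σ
    rw [Finset.mem_singleton]
    exact ⟨fun h' => Om_single h h', fun e => e ▸ h⟩
  unfold tvDist
  refine ciSup_le fun A => ?_
  rw [lawProb_eq h, gProb_eq]
  have e := gExp_PP (β := β) (rect_nonempty hL hm) ξ 0 (A.indicator 1)
  have hw := W_pos (β := β) h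
  unfold ZZ
  rw [hs] at *
  simp only [Finset.sum_singleton] at *
  rw [Function.iterate_one, mul_left_cancel₀ hw.ne' e, mul_div_cancel_left₀ _ hw.ne', sub_self,
    abs_zero]
  positivity

lemma mix_empty (β : ℝ) (ξ : Config) (K : Set ℤ) :
    mixingTime β ∅ ξ K (fun _ => 0) ≤ 1 := by
  have hg : glauber β ∅ ξ K (fun _ => 0) = fun _ _ => 0 := by
    funext η σ; simp [glauber]
  have hc : ∀ t, 0 < t → ∀ η, chainLaw (glauber β ∅ ξ K (fun _ => 0)) t η = fun _ => 0 := by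
    intro t ht η
    obtain ⟨s, rfl⟩ := Nat.exists_eq_succ_of_ne_zero ht.ne'
    funext σ
    simp [chainLaw, hg]
  have hl : ∀ t, 0 < t → ∀ η, lawProb (glauber β ∅ ξ K (fun _ => 0)) t η =
      lawProb (glauber β ∅ ξ K (fun _ => 0)) 1 η := by
    intro t ht η
    funext A
    unfold lawProb
    rw [hc t ht, hc 1 one_pos]
  unfold mixingTime
  set S := {t : ℕ | 0 < t ∧ ∀ η ∈ stateSpace ∅ ξ K,
    tvDist (lawProb (glauber β ∅ ξ K (fun _ => 0)) t η) (gProb β ∅ ξ K (fun _ => 0))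
      ≤ (2 * Real.exp 1)⁻¹} with hS
  rcases S.eq_empty_or_nonempty with h | ⟨t, ht, ht'⟩
  · rw [h]; simp
  · apply Nat.sInf_le
    refine ⟨one_pos, fun η hη => ?_⟩
    rw [← hl t ht]
    exact ht' η hη

lemma CC_le {β : ℝ} (hβ : 0 < β) {L m n : ℕ} (hm : 0 < m) (hn : 0 < n) :
    CC β L m n ≤ 2 * (L:ℝ) ^ 2 * (m:ℝ) ^ 2 * n * Real.exp (7 * β * m * n) := by
  have hm' : (1:ℝ) ≤ m := by exact_mod_cast hm
  have hn' : (1:ℝ) ≤ n := by exact_mod_cast hn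
  have e : CC β L m n = (L:ℝ) ^ 2 * (m:ℝ) ^ 2 * ((n + 1) *
      Real.exp (β * ((4 * m - 2) * n) + 4 * β * n)) := by
    unfold CC; rw [Real.exp_add]; push_cast; ring
  rw [e]
  have h1 : Real.exp (β * ((4 * m - 2) * n) + 4 * β * n) ≤ Real.exp (7 * β * m * n) := by
    rw [Real.exp_le_exp]
    have : 0 ≤ β * n * (3 * m - 2) := mul_nonneg (by positivity) (by linarith)
    linarith
  calc _ ≤ (L:ℝ) ^ 2 * (m:ℝ) ^ 2 * ((2 * n) * Real.exp (7 * β * m * n)) := by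
        gcongr; linarith
    _ = _ := by ring

lemma relax_le {β : ℝ} (hβ : 0 < β) {L m n : ℕ} (hL : m ≤ L) (ξ : Config) :
    relaxTime β (rectLm L m) ξ (Set.Icc 0 (n:ℤ)) (fun _ => 0) ≤
      2 * (L:ℝ) ^ 2 * (m:ℝ) ^ 2 * n * Real.exp (7 * β * m * n) := by
  unfold relaxTime spectralGap
  rcases isEmpty_or_nonempty {f : Config → ℝ //
      ¬ ∀ η ∈ stateSpace (rectLm L m) ξ (Set.Icc 0 (n:ℤ)),
        ∀ η' ∈ stateSpace (rectLm L m) ξ (Set.Icc 0 (n:ℤ)), f η = f η'} with hE | hE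
  · rw [Real.iInf_of_isEmpty, inv_zero]; positivity
  · have hm : 0 < m := by
      by_contra h0
      have h0 : m = 0 := by omega
      subst h0
      obtain ⟨f, hf⟩ := hE
      apply hf
      intro η h η' h'
      congr 1
      funext x
      have hx : x ∉ rectLm L 0 := by rw [mem_rect]; push_cast; omega
      rw [h.2 x hx, h'.2 x hx]
    have hn : 0 < n := by
      by_contra h0
      have h0 : n = 0 := by omega
      subst h0
      obtain ⟨f, hf⟩ := hE
      apply hf
      intro η h η' h'
      rw [Om_single (mem_stateSpace_iff.1 h') (mem_stateSpace_iff.1 h)]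
    have hL' : 0 < L := by omega
    have hC := CC_pos β hL' hm n
    refine le_trans ?_ (CC_le hβ hm hn)
    rw [← inv_inv (CC β L m n)]
    refine inv_anti₀ (inv_pos.2 hC) (le_ciInf ?_)
    rintro ⟨f, hf⟩
    simp only
    have hv : 0 < gVar β (rectLm L m) ξ (Set.Icc 0 (n:ℤ)) (fun _ => 0) f := by
      refine lt_of_le_of_ne (gVar_nonneg _ _ _ _ _) ?_
      intro h0
      apply hf
      have key : ∀ η ∈ stateSpace (rectLm L m) ξ (Set.Icc 0 (n:ℤ)),
          f η = gExp β (rectLm L m) ξ (Set.Icc 0 (n:ℤ)) (fun _ => 0) f := by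
        intro η hη
        have h := mem_stateSpace_iff.1 hη
        have h1 := point_le β ξ n f h
        rw [← h0] at h1
        have hp : 0 < W β (rectLm L m) ξ n η / ZZ β (rectLm L m) ξ n :=
          div_pos (W_pos h) (ZZ_pos _ _ _ _)
        have h2 := nonpos_of_mul_nonpos_right h1 hp
        have h3 := pow_eq_zero_iff (two_ne_zero) |>.1 (le_antisymm h2 (sq_nonneg _))
        linarith
      intro η hη η' hη'
      rw [key η hη, key η' hη']
    rw [le_div_iff₀ hv, inv_mul_le_iff₀ hC]
    exact poincare hβ hL' hm ξ n f

lemma final_num {β : ℝ} (hβ : 0 < β) {L n : ℕ} (hL : 0 < L) (hn : 0 < n) :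
    CC β L L n * ((4 * β + 1) * ((L * L : ℕ) * n) + 4) + 1 ≤
      Real.exp ((15 + 18 / β) * β * L * n) := by
  have hL' : (1:ℝ) ≤ L := by exact_mod_cast hL
  have hn' : (1:ℝ) ≤ n := by exact_mod_cast hn
  have hC := CC_le (L := L) hβ hL hn
  set u : ℝ := (L:ℝ) * n with hu
  have hu1 : 1 ≤ u := one_le_mul_of_one_le_of_one_le hL' hn'
  have hLu : (L:ℝ) ≤ u := le_mul_of_one_le_right (by linarith) hn'
  have hC' : CC β L L n ≤ 2 * u ^ 5 * Real.exp (7 * β * u) := by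
    refine hC.trans ?_
    rw [show 7 * β * (L:ℝ) * n = 7 * β * u by rw [hu]; ring]
    refine mul_le_mul_of_nonneg_right ?_ (Real.exp_pos _).le
    have : (L:ℝ) ^ 4 ≤ u ^ 4 := pow_le_pow_left₀ (by linarith) hLu 4
    have h2 : (n:ℝ) ≤ u := le_mul_of_one_le_left (by linarith) hL'
    have h3 := mul_le_mul this h2 (by linarith) (by positivity)
    nlinarith
  have hR : (4 * β + 1) * (((L * L : ℕ) : ℝ) * n) + 4 ≤ (4 * β + 5) * u ^ 2 := by
    have h1 : ((L * L : ℕ) : ℝ) * n ≤ u ^ 2 := by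
      push_cast
      calc (L:ℝ) * L * n = L * u := by rw [hu]; ring
        _ ≤ u * u := mul_le_mul_of_nonneg_right hLu (by linarith)
        _ = _ := by ring
    have h2 : 1 ≤ u ^ 2 := one_le_pow₀ hu1
    have h3 := mul_le_mul_of_nonneg_left h1 (by positivity : 0 ≤ 4 * β + 1)
    linarith
  have hX := mul_le_mul hC' hR (by positivity) (by positivity)
  have h7 : u ^ 7 ≤ Real.exp (7 * u) := by
    have : u ≤ Real.exp u := by linarith [Real.add_one_le_exp u]
    calc u ^ 7 ≤ (Real.exp u) ^ 7 := pow_le_pow_left₀ (by linarith) this 7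
      _ = _ := by rw [← Real.exp_nat_mul]; norm_num
  have h8 : 8 * β + 11 ≤ Real.exp ((8 * β + 11) * u) := by
    have := Real.add_one_le_exp ((8 * β + 11) * u)
    nlinarith
  have h9 : 1 ≤ u ^ 7 * Real.exp (7 * β * u) :=
    one_le_mul_of_one_le_of_one_le (one_le_pow₀ hu1) (Real.one_le_exp (by positivity))
  calc _ ≤ (8 * β + 11) * (u ^ 7 * Real.exp (7 * β * u)) := by nlinarith
    _ ≤ Real.exp ((8 * β + 11) * u) * (Real.exp (7 * u) * Real.exp (7 * β * u)) := by gcongr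
    _ = Real.exp ((15 + 18 / β) * β * L * n) := by
      rw [← Real.exp_add, ← Real.exp_add]
      congr 1
      rw [hu]
      field_simp
      ring

/-- Proposition 2.3 of the paper. For the SOS Glauber dynamics on
`{1,…,L}×{1,…,m}` with `m ≤ L`, floor at `0`, ceiling at `n⁺` and arbitrary boundary
condition `ξ`, there is `c = c(β)` such that
`T_rel ≤ c L² m² n⁺ exp(7β m n⁺)`; consequently, when `L = m`,
`T_mix = exp(O(β L n⁺))`. -/
theorem sos_canonical_paths_relaxation :
    ∀ β : ℝ, 0 < β → ∃ c : ℝ, 0 < c ∧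
      (∀ L m np : ℕ, m ≤ L → ∀ ξ : Config,
        relaxTime β (rectLm L m) ξ (Set.Icc 0 (np : ℤ)) (fun _ => 0) ≤
          c * (L : ℝ) ^ 2 * (m : ℝ) ^ 2 * (np : ℝ) * Real.exp (7 * β * m * np)) ∧
      (∀ L np : ℕ, ∀ ξ : Config,
        (mixingTime β (rectLm L L) ξ (Set.Icc 0 (np : ℤ)) (fun _ => 0) : ℝ) ≤
          Real.exp (c * β * L * np)) := by
  intro β hβ
  have hβ' : 0 < 18 / β := by positivity
  refine ⟨15 + 18 / β, by positivity, ?_, ?_⟩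
  · intro L m np hmL ξ
    refine (relax_le hβ hmL ξ).trans ?_
    gcongr
    linarith
  · intro L np ξ
    rcases Nat.eq_zero_or_pos L with rfl | hL
    · have e : rectLm 0 0 = ∅ := by
        rw [← Finset.card_eq_zero, card_rect]
      rw [e]
      have h := mix_empty β ξ (Set.Icc 0 (np : ℤ))
      have h' : (mixingTime β ∅ ξ (Set.Icc 0 (np : ℤ)) (fun _ => 0) : ℝ) ≤ 1 := by exact_mod_cast h
      simpa using h'
    · rcases Nat.eq_zero_or_pos np with rfl | hn
      · have h := mix_n_zero β hL hL ξ
        have h' : (mixingTime β (rectLm L L) ξ (Set.Icc 0 ((0:ℕ) : ℤ)) (fun _ => 0) : ℝ) ≤ 1 := by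
          exact_mod_cast h
        simpa using h'
      · exact (mix_le hβ hL hL ξ np).trans (final_num hβ hL hn)

end SOSPaper
end
end

section
/- Let (X(t))_{t=0,1,…} be a discrete-time reversible Markov chain on a finite state space Ω with invariant measure π and transition probabilities p(·,·); set Q(a,b) = π(a)p(a,b), and let p_min = min{p(σ,σ') : p(σ,σ') > 0}. Let G ⊆ Ω and suppose that for some T > 0 and α > 0 one has P^x(X(T) ∈ G) ≥ α for every initial state x ∈ Ω. Suppose further that for every η, η' ∈ G there is a path γ̃(η,η') of states from η to η', each consecutive pair having nonzero transition probability, which stays inside G, and let W(G) = max over pairs (a,b) with a,b ∈ G and Q(a,b) ≠ 0 of (1/Q(a,b))·Σ_{η,η' ∈ G : (a,b) ∈ γ̃(η,η')} |γ̃(η,η')|·π(η)·π(η'). Then the spectral gap satisfies gap^{−1} ≤ (6/α)·( T²/p_min + W(G)/α ). -/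
open scoped Classical

noncomputable section

namespace ChainPaths

variable {Ω : Type*}

/-- `t`-step transition probabilities of the kernel `P` on a finite state space. -/
def matPow [Fintype Ω] (P : Ω → Ω → ℝ) : ℕ → Ω → Ω → ℝ
  | 0 => fun a b => if b = a then 1 else 0
  | (t + 1) => fun a b => ∑ c, matPow P t a c * P c b

/-- The smallest nonzero one-step transition probability. -/
def pmin [Fintype Ω] (P : Ω → Ω → ℝ) : ℝ :=
  sInf {p : ℝ | (∃ a b, P a b = p) ∧ 0 < p}

/-- `(a,b)` is a consecutive pair of states of the path `l`. -/
def pairIn (a b : Ω) (l : List Ω) : Prop := (a, b) ∈ l.zip l.tail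

/-- The congestion constant `W(G)` of the family of paths `γ` inside `G`:
the maximum over pairs `(a,b)` with `a, b ∈ G` and `Q(a,b) = π(a)p(a,b) ≠ 0` of
`Q(a,b)⁻¹ Σ_{η,η' ∈ G : (a,b) ∈ γ(η,η')} |γ(η,η')| π(η) π(η')`. -/
def WG [Fintype Ω] (P : Ω → Ω → ℝ) (π : Ω → ℝ) (G : Finset Ω)
    (γ : Ω → Ω → List Ω) : ℝ :=
  ⨆ p : {p : Ω × Ω // p.1 ∈ G ∧ p.2 ∈ G ∧ π p.1 * P p.1 p.2 ≠ 0},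
    (π p.1.1 * P p.1.1 p.1.2)⁻¹ *
      ∑ η ∈ G, ∑ η' ∈ G,
        if pairIn p.1.1 p.1.2 (γ η η') then ((γ η η').length : ℝ) * π η * π η' else 0

/-- The spectral gap of a reversible chain, via the variational characterization
`gap = inf_{f non-constant} π(f(I−P)f)/Var_π(f)`. -/
def chainGap [Fintype Ω] (P : Ω → Ω → ℝ) (π : Ω → ℝ) : ℝ :=
  ⨅ f : {f : Ω → ℝ // ¬ ∀ a b, f a = f b},
    (∑ a, π a * f.1 a * (f.1 a - ∑ b, P a b * f.1 b)) /
      (∑ a, π a * (f.1 a - ∑ b, π b * f.1 b) ^ 2)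


section helpers

lemma sq_three (u v w : ℝ) : (u + v + w)^2 ≤ 3 * (u^2 + v^2 + w^2) := by
  nlinarith [sq_nonneg (u - v), sq_nonneg (v - w), sq_nonneg (u - w)]

/-- Loop erasure. -/
lemma exists_nodup (l : List Ω) : ∀ x y : Ω, l.head? = some x → l.getLast? = some y →
    ∃ l' : List Ω, l'.head? = some x ∧ l'.getLast? = some y ∧ l'.Nodup ∧
      (∀ p ∈ l'.zip l'.tail, p ∈ l.zip l.tail) ∧ l'.length ≤ l.length := by
  induction l with
  | nil => intro x y h; simp at h
  | cons a l ih =>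
    intro x y hx hy
    simp only [List.head?_cons, Option.some.injEq] at hx
    subst hx
    cases l with
    | nil =>
      refine ⟨[a], by simp, hy, by simp, by simp, by simp⟩
    | cons b l =>
      obtain ⟨l', h1, h2, h3, h4, h5⟩ := ih b y (by simp) (by simpa using hy)
      by_cases ha : a ∈ l'
      · obtain ⟨s, t, rfl⟩ := List.append_of_mem ha
        refine ⟨a :: t, by simp, ?_, ?_, ?_, ?_⟩
        · simpa [List.getLast?_append] using h2
        · exact (List.nodup_append.1 h3).2.1
        · intro p hp
          have : p ∈ (s ++ a :: t).zip (s ++ a :: t).tail := by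
            clear h1 h2 h3 h4 h5 ha
            induction s with
            | nil => simpa using hp
            | cons c s ihs =>
              cases s with
              | nil => simp at hp ⊢; exact Or.inr hp
              | cons d s => 
                simp only [List.cons_append, List.tail_cons, List.zip_cons_cons, List.mem_cons] at ihs ⊢
                exact Or.inr ihs
          have := h4 p this
          simp only [List.tail_cons, List.zip_cons_cons, List.mem_cons] at this ⊢
          exact Or.inr this
        · simp at h5 ⊢; omega
      · cases l' with
        | nil => simp at h1
        | cons c l' =>
          simp only [List.head?_cons, Option.some.injEq] at h1
          subst h1
          refine ⟨a :: c :: l', by simp, by simpa using h2, List.nodup_cons.2 ⟨ha, h3⟩, ?_, ?_⟩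
          · intro p hp
            simp only [List.tail_cons, List.zip_cons_cons, List.mem_cons] at hp ⊢
            rcases hp with hp | hp
            · exact Or.inl hp
            · have := h4 p (by simpa using hp)
              exact Or.inr (by simpa using this)
          · simpa using h5

lemma abs_le_zip (f : Ω → ℝ) (l : List Ω) : ∀ x y : Ω, l.head? = some x → l.getLast? = some y →
    |f x - f y| ≤ ((l.zip l.tail).map (fun p => |f p.1 - f p.2|)).sum := by
  induction l with
  | nil => intro x y h; simp at h
  | cons a l ih =>
    intro x y hx hy
    simp only [List.head?_cons, Option.some.injEq] at hx
    subst hx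
    cases l with
    | nil => simp at hy; simp [hy]
    | cons b l =>
      have := ih b y (by simp) (by simpa using hy)
      simp only [List.tail_cons, List.zip_cons_cons, List.map_cons, List.sum_cons] at this ⊢
      have h := abs_sub_le (f a) (f b) (f y)
      linarith

lemma zip_nodup (l : List Ω) (h : l.Nodup) : (l.zip l.tail).Nodup := by
  induction l with
  | nil => simp
  | cons a l ih =>
    cases l with
    | nil => simp
    | cons b l =>
      simp only [List.tail_cons, List.zip_cons_cons]
      rw [List.nodup_cons] at h ⊢
      refine ⟨fun hm => h.1 ?_, ih h.2⟩
      exact (List.of_mem_zip hm).1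

lemma path_bound [Fintype Ω] (f : Ω → ℝ) (l : List Ω) (x y : Ω) (hx : l.head? = some x)
    (hy : l.getLast? = some y) :
    (f x - f y)^2 ≤ l.length * ∑ a, ∑ b, if pairIn a b l then (f a - f b)^2 else 0 := by
  obtain ⟨l', h1, h2, h3, h4, h5⟩ := exists_nodup l x y hx hy
  have hz := zip_nodup l' h3
  have hA := abs_le_zip f l' x y h1 h2
  rw [← List.sum_toFinset _ hz] at hA
  have hB : (f x - f y)^2 ≤ (∑ p ∈ (l'.zip l'.tail).toFinset, |f p.1 - f p.2|)^2 := by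
    rw [← sq_abs (f x - f y)]
    exact pow_le_pow_left₀ (abs_nonneg _) hA 2
  have hC := sq_sum_le_card_mul_sum_sq (s := (l'.zip l'.tail).toFinset)
    (f := fun p : Ω × Ω => |f p.1 - f p.2|)
  have hcard : (((l'.zip l'.tail).toFinset.card : ℕ) : ℝ) ≤ l.length := by
    have h6 := List.toFinset_card_le (l'.zip l'.tail)
    have h7 : (l'.zip l'.tail).length ≤ l'.length := by simp [List.length_zip]
    exact_mod_cast h6.trans (h7.trans h5)
  have hD : ∑ p ∈ (l'.zip l'.tail).toFinset, |f p.1 - f p.2|^2 ≤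
      ∑ a, ∑ b, if pairIn a b l then (f a - f b)^2 else 0 := by
    rw [← Fintype.sum_prod_type' (f := fun a b => if pairIn a b l then (f a - f b)^2 else 0)]
    rw [← Finset.sum_filter]
    simp only [sq_abs]
    apply Finset.sum_le_sum_of_subset_of_nonneg
    · intro p hp
      simp only [List.mem_toFinset] at hp
      simp only [Finset.mem_filter, Finset.mem_univ, true_and]
      exact h4 p hp
    · intros; positivity
  refine hB.trans (hC.trans ?_)
  apply mul_le_mul hcard hD (Finset.sum_nonneg fun _ _ => by positivity) (by positivity)

variable [Fintype Ω]

lemma matPow_nonneg (P : Ω → Ω → ℝ) (hPnn : ∀ a b, 0 ≤ P a b) (t : ℕ) :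
    ∀ a b, 0 ≤ matPow P t a b := by
  induction t with
  | zero => intro a b; simp only [matPow]; split_ifs <;> norm_num
  | succ t ih => intro a b; exact Finset.sum_nonneg fun c _ => mul_nonneg (ih a c) (hPnn c b)

lemma matPow_stat (P : Ω → Ω → ℝ) (π : Ω → ℝ) (hst : ∀ b, ∑ a, π a * P a b = π b) (t : ℕ) :
    ∀ b, ∑ a, π a * matPow P t a b = π b := by
  induction t with
  | zero => intro b; simp [matPow]
  | succ t ih =>
    intro b
    simp only [matPow, Finset.mul_sum]
    rw [Finset.sum_comm]
    conv_rhs => rw [← hst b]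
    refine Finset.sum_congr rfl fun c _ => ?_
    rw [← ih c, Finset.sum_mul]
    exact Finset.sum_congr rfl fun a _ => by ring

/-- The quadratic displacement at time `t`. -/
lemma disp_bound (P : Ω → Ω → ℝ) (π : Ω → ℝ) (hPnn : ∀ a b, 0 ≤ P a b)
    (hProw : ∀ a, ∑ b, P a b = 1) (hπnn : ∀ a, 0 ≤ π a)
    (hst : ∀ b, ∑ a, π a * P a b = π b) (f : Ω → ℝ) (t : ℕ) :
    ∑ x, ∑ y, π x * matPow P (t+1) x y * (f x - f y)^2 ≤
      ((t : ℝ)+1)^2 * ∑ x, ∑ y, π x * P x y * (f x - f y)^2 := by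
  induction t with
  | zero => simp [matPow]
  | succ t ih =>
    set E := ∑ x, ∑ y, π x * P x y * (f x - f y)^2 with hE
    set M := matPow P (t+1) with hM
    have hMnn := matPow_nonneg P hPnn (t+1)
    have hMst := matPow_stat P π hst (t+1)
    rw [← hM] at hMnn hMst
    set s : ℝ := (t:ℝ)+1 with hs
    have hs0 : 0 < s := by positivity
    have key : s * ∑ x, ∑ y, π x * matPow P (t+1+1) x y * (f x - f y)^2 ≤
        ∑ x, ∑ y, ∑ c, π x * (M x c * P c y) *
          ((s+1) * (f x - f c)^2 + s*(s+1) * (f c - f y)^2) := by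
      rw [Finset.mul_sum]
      refine Finset.sum_le_sum fun x _ => ?_
      rw [Finset.mul_sum]
      refine Finset.sum_le_sum fun y _ => ?_
      have : matPow P (t+1+1) x y = ∑ c, M x c * P c y := rfl
      rw [this, Finset.mul_sum, Finset.sum_mul, Finset.mul_sum]
      refine Finset.sum_le_sum fun c _ => ?_
      have h0 : 0 ≤ π x * (M x c * P c y) :=
        mul_nonneg (hπnn x) (mul_nonneg (hMnn x c) (hPnn c y))
      have h1 : s * (f x - f y)^2 ≤ (s+1) * (f x - f c)^2 + s*(s+1) * (f c - f y)^2 := by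
        nlinarith [sq_nonneg ((f x - f c) - s * (f c - f y))]
      calc _ = π x * (M x c * P c y) * (s * (f x - f y)^2) := by ring
        _ ≤ _ := mul_le_mul_of_nonneg_left h1 h0
    have e1 : ∑ x, ∑ y, ∑ c, π x * (M x c * P c y) *
          ((s+1) * (f x - f c)^2 + s*(s+1) * (f c - f y)^2) =
        (s+1) * ∑ x, ∑ y, π x * M x y * (f x - f y)^2 + s*(s+1) * E := by
      have a1 : ∑ x, ∑ y, ∑ c, π x * (M x c * P c y) * ((s+1) * (f x - f c)^2) =
          (s+1) * ∑ x, ∑ y, π x * M x y * (f x - f y)^2 := by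
        rw [Finset.mul_sum]
        refine Finset.sum_congr rfl fun x _ => ?_
        rw [Finset.sum_comm, Finset.mul_sum]
        refine Finset.sum_congr rfl fun c _ => ?_
        calc _ = ∑ y, P c y * (π x * M x c * ((s+1) * (f x - f c)^2)) :=
              Finset.sum_congr rfl fun y _ => by ring
          _ = _ := by rw [← Finset.sum_mul, hProw]; ring
      have a2 : ∑ x, ∑ y, ∑ c, π x * (M x c * P c y) * (s*(s+1) * (f c - f y)^2) =
          s*(s+1) * E := by
        rw [hE, Finset.mul_sum]
        calc _ = ∑ x, ∑ c, ∑ y, π x * (M x c * P c y) * (s*(s+1) * (f c - f y)^2) :=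
              Finset.sum_congr rfl fun x _ => Finset.sum_comm
          _ = ∑ c, ∑ x, ∑ y, π x * (M x c * P c y) * (s*(s+1) * (f c - f y)^2) :=
              Finset.sum_comm
          _ = _ := by
            refine Finset.sum_congr rfl fun c _ => ?_
            rw [Finset.sum_comm, Finset.mul_sum]
            refine Finset.sum_congr rfl fun y _ => ?_
            rw [← hMst c, Finset.sum_mul, Finset.sum_mul, Finset.mul_sum]
            exact Finset.sum_congr rfl fun x _ => by ring
      rw [← a1, ← a2]
      simp only [mul_add, Finset.sum_add_distrib]
    rw [e1] at key
    have h2 := mul_le_mul_of_nonneg_left ih (by positivity : 0 ≤ s+1)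
    have h3 : s * ∑ x, ∑ y, π x * matPow P (t+1+1) x y * (f x - f y)^2 ≤ s * ((s+1)^2 * E) := by
      refine key.trans ((add_le_add_left h2 _).trans (le_of_eq ?_))
      ring
    have h4 := le_of_mul_le_mul_left h3 hs0
    push_cast
    exact h4

lemma var_eq (π : Ω → ℝ) (hπsum : ∑ a, π a = 1) (f : Ω → ℝ) :
    ∑ a, ∑ b, π a * π b * (f a - f b)^2 = 2 * ∑ a, π a * (f a - ∑ b, π b * f b)^2 := by
  set m := ∑ b, π b * f b with hm
  set S := ∑ b, π b * f b ^ 2 with hS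
  have h1 : ∀ a, ∑ b, π a * π b * (f a - f b)^2 = π a * f a^2 - 2 * m * (π a * f a) + S * π a := by
    intro a
    calc _ = ∑ b, (π b * (π a * f a^2) - (π b * f b) * (2 * π a * f a) + (π b * f b^2) * π a) :=
          Finset.sum_congr rfl fun b _ => by ring
      _ = _ := by
        rw [Finset.sum_add_distrib, Finset.sum_sub_distrib, ← Finset.sum_mul, ← Finset.sum_mul,
          ← Finset.sum_mul, hπsum, ← hm, ← hS]; ring
  simp only [h1]
  rw [Finset.sum_add_distrib, Finset.sum_sub_distrib, ← Finset.mul_sum, ← Finset.mul_sum, hπsum,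
    ← hm, ← hS]
  have h2 : ∑ a, π a * (f a - m)^2 = S - 2 * m * m + m^2 := by
    calc _ = ∑ a, (π a * f a ^2 - 2 * m * (π a * f a) + m^2 * π a) :=
          Finset.sum_congr rfl fun b _ => by ring
      _ = _ := by
        rw [Finset.sum_add_distrib, Finset.sum_sub_distrib, ← Finset.mul_sum, ← Finset.mul_sum,
          hπsum, ← hm, ← hS]; ring
  rw [h2]; ring

lemma dir_eq (P : Ω → Ω → ℝ) (π : Ω → ℝ) (hProw : ∀ a, ∑ b, P a b = 1)
    (hst : ∀ b, ∑ a, π a * P a b = π b) (f : Ω → ℝ) :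
    ∑ a, ∑ b, π a * P a b * (f a - f b)^2 = 2 * ∑ a, π a * f a * (f a - ∑ b, P a b * f b) := by
  have h1 : ∑ a, ∑ b, π a * P a b * (f b)^2 = ∑ a, π a * f a^2 := by
    rw [Finset.sum_comm]
    refine Finset.sum_congr rfl fun b _ => ?_
    rw [← Finset.sum_mul, hst]
  have h2 : ∑ a, ∑ b, π a * P a b * (f a - f b)^2 =
      ∑ a, (2 * (π a * f a * (f a - ∑ b, P a b * f b)) - π a * f a ^2)
       + ∑ a, ∑ b, π a * P a b * (f b)^2 := by
    rw [← Finset.sum_add_distrib]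
    refine Finset.sum_congr rfl fun a _ => ?_
    calc _ = ∑ b, (P a b * (π a * f a^2) - (P a b * f b) * (2 * π a * f a) 
              + π a * P a b * (f b)^2) :=
          Finset.sum_congr rfl fun b _ => by ring
      _ = _ := by
        rw [Finset.sum_add_distrib, Finset.sum_sub_distrib, ← Finset.sum_mul, ← Finset.sum_mul,
          hProw]; ring
  rw [h2, h1, Finset.sum_sub_distrib, ← Finset.mul_sum]; ring

lemma three_split {ι : Type*} [Fintype ι] (μ : ι → ℝ) (hμ : ∀ i, 0 ≤ μ i) (hs : ∑ i, μ i = 1)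
    (F H : ι → ℝ) :
    ∑ i, ∑ j, μ i * μ j * (F i - F j)^2 ≤
      6 * ∑ i, μ i * (F i - H i)^2 + 3 * ∑ i, ∑ j, μ i * μ j * (H i - H j)^2 := by
  set A := ∑ i, μ i * (F i - H i)^2 with hA
  have h1 : ∑ i, ∑ j, μ i * μ j * (F i - F j)^2 ≤
      ∑ i, ∑ j, ((3 * (μ i * (F i - H i)^2)) * μ j + (3 * μ i) * (μ j * (F j - H j)^2)
        + 3 * (μ i * μ j * (H i - H j)^2)) := by
    refine Finset.sum_le_sum fun i _ => Finset.sum_le_sum fun j _ => ?_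
    have := sq_three (F i - H i) (H i - H j) (H j - F j)
    have h := mul_le_mul_of_nonneg_left this (mul_nonneg (hμ i) (hμ j))
    have e : F i - H i + (H i - H j) + (H j - F j) = F i - F j := by ring
    rw [e] at h
    refine h.trans (le_of_eq (by ring))
  refine h1.trans (le_of_eq ?_)
  simp only [Finset.sum_add_distrib, ← Finset.mul_sum, ← Finset.sum_mul]
  rw [hs, ← hA]; ring

lemma G_bound (P : Ω → Ω → ℝ) (π : Ω → ℝ) (hPnn : ∀ a b, 0 ≤ P a b) (hπ : ∀ a, 0 < π a)
    (G : Finset Ω) (γ : Ω → Ω → List Ω)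
    (hpath : ∀ η ∈ G, ∀ η' ∈ G,
      (γ η η').head? = some η ∧ (γ η η').getLast? = some η' ∧
        (∀ p ∈ (γ η η').zip (γ η η').tail, P p.1 p.2 ≠ 0) ∧
        (∀ z ∈ γ η η', z ∈ G)) (f : Ω → ℝ) :
    ∑ η ∈ G, ∑ η' ∈ G, π η * π η' * (f η - f η')^2 ≤
      WG P π G γ * ∑ a, ∑ b, π a * P a b * (f a - f b)^2 := by
  set S : Ω → Ω → ℝ := fun a b => ∑ η ∈ G, ∑ η' ∈ G,
        if pairIn a b (γ η η') then ((γ η η').length : ℝ) * π η * π η' else 0 with hS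
  have hSb : ∀ a b, S a b ≤ WG P π G γ * (π a * P a b) := by
    intro a b
    by_cases h : a ∈ G ∧ b ∈ G ∧ π a * P a b ≠ 0
    · have hpos : 0 < π a * P a b :=
        lt_of_le_of_ne (mul_nonneg (hπ a).le (hPnn a b)) (Ne.symm h.2.2)
      have := le_ciSup (f := fun p : {p : Ω × Ω // p.1 ∈ G ∧ p.2 ∈ G ∧ π p.1 * P p.1 p.2 ≠ 0} =>
        (π p.1.1 * P p.1.1 p.1.2)⁻¹ * S p.1.1 p.1.2) (Set.finite_range _).bddAbove ⟨(a, b), h⟩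
      have h2 : (π a * P a b)⁻¹ * S a b ≤ WG P π G γ := this
      rwa [inv_mul_le_iff₀ hpos, mul_comm] at h2
    · have h0 : S a b = 0 := by
        refine Finset.sum_eq_zero fun η hη => Finset.sum_eq_zero fun η' hη' => ?_
        rw [if_neg]
        intro hp
        apply h
        obtain ⟨-, -, h3, h4⟩ := hpath η hη η' hη'
        have h5 := List.of_mem_zip hp
        exact ⟨h4 _ h5.1, h4 _ (List.mem_of_mem_tail h5.2), mul_ne_zero (hπ a).ne' (h3 _ hp)⟩
      rw [h0]
      refine mul_nonneg (Real.iSup_nonneg fun p => ?_) (mul_nonneg (hπ a).le (hPnn a b))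
      refine mul_nonneg (inv_nonneg.2 (mul_nonneg (hπ _).le (hPnn _ _))) ?_
      refine Finset.sum_nonneg fun η _ => Finset.sum_nonneg fun η' _ => ?_
      have := hπ η
      have := hπ η'
      split_ifs <;> positivity
  calc ∑ η ∈ G, ∑ η' ∈ G, π η * π η' * (f η - f η')^2
      ≤ ∑ η ∈ G, ∑ η' ∈ G, ∑ a, ∑ b,
        (if pairIn a b (γ η η') then ((γ η η').length : ℝ) * π η * π η' else 0) *
          (f a - f b)^2 := by
        refine Finset.sum_le_sum fun η hη => Finset.sum_le_sum fun η' hη' => ?_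
        obtain ⟨h1, h2, -, -⟩ := hpath η hη η' hη'
        refine (mul_le_mul_of_nonneg_left (path_bound f _ η η' h1 h2)
          (mul_nonneg (hπ η).le (hπ η').le)).trans (le_of_eq ?_)
        rw [← mul_assoc, Finset.mul_sum]
        refine Finset.sum_congr rfl fun a _ => ?_
        rw [Finset.mul_sum]
        refine Finset.sum_congr rfl fun b _ => ?_
        split_ifs <;> ring
    _ = ∑ a, ∑ b, S a b * (f a - f b)^2 := by
        simp only [hS, Finset.sum_mul]
        rw [Finset.sum_congr rfl fun η _ => Finset.sum_comm, Finset.sum_comm]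
        refine Finset.sum_congr rfl fun a _ => ?_
        rw [Finset.sum_congr rfl fun η _ => Finset.sum_comm, Finset.sum_comm]
    _ ≤ ∑ a, ∑ b, WG P π G γ * (π a * P a b) * (f a - f b)^2 := by
        refine Finset.sum_le_sum fun a _ => Finset.sum_le_sum fun b _ => ?_
        exact mul_le_mul_of_nonneg_right (hSb a b) (sq_nonneg _)
    _ = _ := by
        simp only [Finset.mul_sum]
        exact Finset.sum_congr rfl fun a _ => Finset.sum_congr rfl fun b _ => by ring

lemma pair_fst (μ : Ω × Ω → ℝ) (g : Ω → Ω → ℝ) :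
    ∑ i, ∑ j, μ i * μ j * g i.1 j.1 =
      ∑ x, ∑ x', (∑ y, μ (x, y)) * (∑ y, μ (x', y)) * g x x' := by
  rw [Fintype.sum_prod_type]
  refine Finset.sum_congr rfl fun x _ => ?_
  simp only [Fintype.sum_prod_type]
  rw [Finset.sum_comm]
  refine Finset.sum_congr rfl fun x' _ => ?_
  rw [Finset.sum_mul_sum, Finset.sum_mul]
  exact Finset.sum_congr rfl fun y _ => by rw [Finset.sum_mul]

lemma pair_snd (μ : Ω × Ω → ℝ) (g : Ω → Ω → ℝ) :
    ∑ i, ∑ j, μ i * μ j * g i.2 j.2 =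
      ∑ y, ∑ y', (∑ x, μ (x, y)) * (∑ x, μ (x, y')) * g y y' := by
  rw [Fintype.sum_prod_type_right]
  refine Finset.sum_congr rfl fun x _ => ?_
  simp only [Fintype.sum_prod_type_right]
  rw [Finset.sum_comm]
  refine Finset.sum_congr rfl fun x' _ => ?_
  rw [Finset.sum_mul_sum, Finset.sum_mul]
  exact Finset.sum_congr rfl fun y _ => by rw [Finset.sum_mul]

lemma WG_nonneg (P : Ω → Ω → ℝ) (π : Ω → ℝ) (hPnn : ∀ a b, 0 ≤ P a b) (hπ : ∀ a, 0 ≤ π a)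
    (G : Finset Ω) (γ : Ω → Ω → List Ω) : 0 ≤ WG P π G γ := by
  refine Real.iSup_nonneg fun p => ?_
  refine mul_nonneg (inv_nonneg.2 (mul_nonneg (hπ _) (hPnn _ _))) ?_
  refine Finset.sum_nonneg fun η _ => Finset.sum_nonneg fun η' _ => ?_
  have := hπ η
  have := hπ η'
  split_ifs <;> positivity

lemma pmin_pos_le [Nonempty Ω] (P : Ω → Ω → ℝ) (hPnn : ∀ a b, 0 ≤ P a b)
    (hProw : ∀ a, ∑ b, P a b = 1) : 0 < pmin P ∧ pmin P ≤ 1 := by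
  have hne : {p : ℝ | (∃ a b, P a b = p) ∧ 0 < p}.Nonempty := by
    obtain ⟨a⟩ := ‹Nonempty Ω›
    have : ∃ b ∈ Finset.univ, 0 < P a b := by
      by_contra h
      push Not at h
      have := Finset.sum_nonpos h
      rw [hProw] at this
      linarith
    obtain ⟨b, -, hb⟩ := this
    exact ⟨P a b, ⟨a, b, rfl⟩, hb⟩
  have hfin : {p : ℝ | (∃ a b, P a b = p) ∧ 0 < p}.Finite := by
    refine (Set.finite_range (fun q : Ω × Ω => P q.1 q.2)).subset ?_
    rintro p ⟨⟨a, b, rfl⟩, -⟩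
    exact ⟨(a, b), rfl⟩
  obtain ⟨⟨a, b, hab⟩, hpos⟩ := hne.csInf_mem hfin
  refine ⟨hpos, ?_⟩
  change sInf _ ≤ _
  rw [← hab, ← hProw a]
  exact Finset.single_le_sum (fun c _ => hPnn a c) (Finset.mem_univ b)

lemma poincare (P : Ω → Ω → ℝ) (π : Ω → ℝ)
    (hPnn : ∀ a b, 0 ≤ P a b) (hProw : ∀ a, ∑ b, P a b = 1)
    (hπ : ∀ a, 0 < π a) (hπsum : ∑ a, π a = 1)
    (hst : ∀ b, ∑ a, π a * P a b = π b)
    (G : Finset Ω) (T : ℕ) (hT : 0 < T) (α : ℝ) (hα : 0 < α)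
    (hhit : ∀ x : Ω, α ≤ ∑ y ∈ G, matPow P T x y)
    (γ : Ω → Ω → List Ω)
    (hpath : ∀ η ∈ G, ∀ η' ∈ G,
      (γ η η').head? = some η ∧ (γ η η').getLast? = some η' ∧
        (∀ p ∈ (γ η η').zip (γ η η').tail, P p.1 p.2 ≠ 0) ∧
        (∀ z ∈ γ η η', z ∈ G)) (f : Ω → ℝ) :
    ∑ a, ∑ b, π a * π b * (f a - f b)^2 ≤
      (6 / α * (T:ℝ)^2 + 3 * WG P π G γ / α^2) * ∑ a, ∑ b, π a * P a b * (f a - f b)^2 := by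
  set E := ∑ a, ∑ b, π a * P a b * (f a - f b)^2 with hE
  set M := matPow P T with hM
  have hMnn : ∀ a b, 0 ≤ M a b := matPow_nonneg P hPnn T
  have hMst : ∀ b, ∑ a, π a * M a b = π b := matPow_stat P π hst T
  set s : Ω → ℝ := fun x => ∑ y ∈ G, M x y with hs
  have hspos : ∀ x, 0 < s x := fun x => hα.trans_le (hhit x)
  set μ : Ω × Ω → ℝ := fun p => if p.2 ∈ G then π p.1 * M p.1 p.2 / s p.1 else 0 with hμ
  have hμnn : ∀ i, 0 ≤ μ i := by
    intro i
    simp only [hμ]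
    split_ifs
    · exact div_nonneg (mul_nonneg (hπ _).le (hMnn _ _)) (hspos _).le
    · exact le_rfl
  have hμle : ∀ x y, μ (x, y) ≤ π x * M x y / α := by
    intro x y
    simp only [hμ]
    have h0 := mul_nonneg (hπ x).le (hMnn x y)
    split_ifs
    · exact div_le_div_of_nonneg_left h0 hα (hhit x)
    · exact div_nonneg h0 hα.le
  have hm1 : ∀ x, ∑ y, μ (x, y) = π x := by
    intro x
    simp only [hμ]
    rw [← Finset.sum_filter, Finset.filter_mem_eq_inter, Finset.univ_inter]
    rw [← Finset.sum_div, ← Finset.mul_sum]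
    exact mul_div_cancel_right₀ _ (hspos x).ne'
  have hm2 : ∀ y ∈ G, ∑ x, μ (x, y) ≤ π y / α := by
    intro y _
    refine (Finset.sum_le_sum fun x _ => hμle x y).trans (le_of_eq ?_)
    rw [← Finset.sum_div, hMst]
  have hm3 : ∀ y, y ∉ G → ∑ x, μ (x, y) = 0 := by
    intro y hy
    simp [hμ, hy]
  have hμs : ∑ i, μ i = 1 := by
    rw [Fintype.sum_prod_type]; simp only [hm1, hπsum]
  have key := three_split μ hμnn hμs (fun p => f p.1) (fun p => f p.2)
  rw [pair_fst μ (fun a b => (f a - f b)^2), pair_snd μ (fun a b => (f a - f b)^2)] at key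
  simp only [hm1] at key
  have hA : ∑ i, μ i * (f i.1 - f i.2)^2 ≤ (T:ℝ)^2 * E / α := by
    obtain ⟨t, rfl⟩ : ∃ t, T = t + 1 := ⟨T - 1, by omega⟩
    have hd := disp_bound P π hPnn hProw (fun a => (hπ a).le) hst f t
    rw [le_div_iff₀ hα]
    push_cast
    refine le_trans ?_ hd
    rw [Fintype.sum_prod_type, Finset.sum_mul]
    refine Finset.sum_le_sum fun x _ => ?_
    rw [Finset.sum_mul]
    refine Finset.sum_le_sum fun y _ => ?_
    have h1 := hμle x y
    rw [le_div_iff₀ hα] at h1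
    calc _ = (μ (x, y) * α) * (f x - f y)^2 := by ring
      _ ≤ _ := mul_le_mul_of_nonneg_right h1 (sq_nonneg _)
  have hB : ∑ y, ∑ y', (∑ x, μ (x, y)) * (∑ x, μ (x, y')) * (f y - f y')^2 ≤
      WG P π G γ * E / α^2 := by
    rw [le_div_iff₀ (by positivity)]
    refine le_trans ?_ (G_bound P π hPnn hπ G γ hpath f)
    rw [← Finset.sum_subset (Finset.subset_univ G) (fun y _ hy => by simp [hm3 y hy]),
      Finset.sum_mul]
    refine Finset.sum_le_sum fun y hy => ?_
    rw [← Finset.sum_subset (Finset.subset_univ G) (fun y _ hy => by simp [hm3 y hy]),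
      Finset.sum_mul]
    refine Finset.sum_le_sum fun y' hy' => ?_
    have h1 := hm2 y hy
    have h2 := hm2 y' hy'
    have h3 := mul_le_mul h1 h2 (Finset.sum_nonneg fun _ _ => hμnn _)
      (div_nonneg (hπ y).le hα.le)
    calc _ ≤ (π y / α * (π y' / α)) * (f y - f y')^2 * α^2 := by gcongr
      _ = _ := by field_simp
  calc _ ≤ _ := key
    _ ≤ 6 * ((T:ℝ)^2 * E / α) + 3 * (WG P π G γ * E / α^2) := by gcongr
    _ = _ := by ring

end helpers

/-- Theorem 2.4 of the paper. Let `(X(t))` be a reversible Markov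
chain on a finite state space `Ω` with invariant measure `π`, let `G ⊆ Ω`, and suppose
that `P^x(X(T) ∈ G) ≥ α` for every starting state `x`. Suppose that for every
`η, η' ∈ G` there is a path `γ̃(η,η')` from `η` to `η'` of admissible transitions which
stays inside `G`. Then `gap⁻¹ ≤ (6/α)(T²/p_min + W(G)/α)`. -/
theorem gap_bound_from_paths_and_hitting
    [Fintype Ω] [Nonempty Ω]
    (P : Ω → Ω → ℝ) (π : Ω → ℝ)
    (hPnn : ∀ a b, 0 ≤ P a b) (hProw : ∀ a, ∑ b, P a b = 1)
    (hπnn : ∀ a, 0 ≤ π a) (hπsum : ∑ a, π a = 1)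
    (hrev : ∀ a b, π a * P a b = π b * P b a)
    (G : Finset Ω) (T : ℕ) (hT : 0 < T) (α : ℝ) (hα : 0 < α)
    (hhit : ∀ x : Ω, α ≤ ∑ y ∈ G, matPow P T x y)
    (γ : Ω → Ω → List Ω)
    (hpath : ∀ η ∈ G, ∀ η' ∈ G,
      (γ η η').head? = some η ∧ (γ η η').getLast? = some η' ∧
        (∀ p ∈ (γ η η').zip (γ η η').tail, P p.1 p.2 ≠ 0) ∧
        (∀ z ∈ γ η η', z ∈ G)) :
    (chainGap P π)⁻¹ ≤ (6 / α) * ((T : ℝ) ^ 2 / pmin P + WG P π G γ / α) := by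
  have hst : ∀ b, ∑ a, π a * P a b = π b := by
    intro b
    simp only [hrev _ b]
    rw [← Finset.mul_sum, hProw, mul_one]
  obtain ⟨hp0, hp1⟩ := pmin_pos_le P hPnn hProw
  have hW := WG_nonneg P π hPnn hπnn G γ
  have hC : 0 ≤ (6 / α) * ((T : ℝ) ^ 2 / pmin P + WG P π G γ / α) := by positivity
  rcases le_or_gt (chainGap P π) 0 with hg | hg
  · exact (inv_nonpos.2 hg).trans hC
  have hE : ∀ f : Ω → ℝ, 0 ≤ ∑ a, ∑ b, π a * P a b * (f a - f b)^2 := fun f =>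
    Finset.sum_nonneg fun a _ => Finset.sum_nonneg fun b _ =>
      mul_nonneg (mul_nonneg (hπnn a) (hPnn a b)) (sq_nonneg _)
  have hbdd : BddBelow (Set.range fun f : {f : Ω → ℝ // ¬ ∀ a b, f a = f b} =>
    (∑ a, π a * f.1 a * (f.1 a - ∑ b, P a b * f.1 b)) /
      (∑ a, π a * (f.1 a - ∑ b, π b * f.1 b) ^ 2)) := by
    refine ⟨0, ?_⟩
    rintro _ ⟨f, rfl⟩
    have h1 := dir_eq P π hProw hst f.1
    have h2 := hE f.1
    refine div_nonneg (by linarith) ?_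
    exact Finset.sum_nonneg fun a _ => mul_nonneg (hπnn a) (sq_nonneg _)
  have hlow : ∀ f : {f : Ω → ℝ // ¬ ∀ a b, f a = f b}, chainGap P π ≤
    (∑ a, π a * f.1 a * (f.1 a - ∑ b, P a b * f.1 b)) /
      (∑ a, π a * (f.1 a - ∑ b, π b * f.1 b) ^ 2) := fun f => ciInf_le hbdd f
  have hne : Nonempty {f : Ω → ℝ // ¬ ∀ a b, f a = f b} := by
    by_contra h
    rw [not_nonempty_iff] at h
    rw [chainGap, Real.iInf_of_isEmpty] at hg
    exact lt_irrefl _ hg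
  have hπ : ∀ a, 0 < π a := by
    intro a
    refine lt_of_le_of_ne (hπnn a) fun h0 => ?_
    obtain ⟨f, hf⟩ := hne
    have hb : ∃ b, b ≠ a := by
      by_contra hb
      push Not at hb
      exact hf fun x y => by rw [hb x, hb y]
    obtain ⟨b, hb⟩ := hb
    have := hlow ⟨fun x => if x = a then 1 else 0, fun h => by simpa [hb] using h a b⟩
    have hz : ∀ c, π c * (if c = a then (1:ℝ) else 0) = 0 := by
      intro c
      split_ifs with h
      · rw [h, ← h0]; simp
      · simp
    simp only [hz, zero_mul, Finset.sum_const_zero, zero_div] at this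
    linarith
  have hbound : ∀ f : {f : Ω → ℝ // ¬ ∀ a b, f a = f b},
      ((6 / α) * ((T : ℝ) ^ 2 / pmin P + WG P π G γ / α))⁻¹ ≤
    (∑ a, π a * f.1 a * (f.1 a - ∑ b, P a b * f.1 b)) /
      (∑ a, π a * (f.1 a - ∑ b, π b * f.1 b) ^ 2) := by
    intro f
    have h1 := dir_eq P π hProw hst f.1
    have h2 := var_eq π hπsum f.1
    have h3 := poincare P π hPnn hProw hπ hπsum hst G T hT α hα hhit γ hpath f.1
    have h4 := hg.trans_le (hlow f)
    have h5 := hE f.1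
    have hV : 0 ≤ ∑ a, π a * (f.1 a - ∑ b, π b * f.1 b) ^ 2 :=
      Finset.sum_nonneg fun a _ => mul_nonneg (hπnn a) (sq_nonneg _)
    have hcc : 6 / α * (T:ℝ)^2 + 3 * WG P π G γ / α^2 ≤
        (6 / α) * ((T : ℝ) ^ 2 / pmin P + WG P π G γ / α) := by
      have e1 : (T:ℝ)^2 ≤ (T:ℝ)^2 / pmin P := le_div_self (by positivity) hp0 hp1
      have e2 : 6 / α * (T:ℝ)^2 ≤ 6 / α * ((T:ℝ)^2 / pmin P) := by gcongr
      have e3 : 3 * WG P π G γ / α^2 ≤ 6 / α * (WG P π G γ / α) := by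
        have : 6 / α * (WG P π G γ / α) = 6 * WG P π G γ / α^2 := by field_simp
        rw [this]
        gcongr
        norm_num
      rw [mul_add]
      linarith
    have h6 := h3.trans (mul_le_mul_of_nonneg_right hcc h5)
    set C := (6 / α) * ((T : ℝ) ^ 2 / pmin P + WG P π G γ / α) with hCdef
    rw [h1, h2] at h6
    set D := ∑ a, π a * f.1 a * (f.1 a - ∑ b, P a b * f.1 b)
    set V := ∑ a, π a * (f.1 a - ∑ b, π b * f.1 b) ^ 2
    have hV' : 0 < V := lt_of_le_of_ne hV fun h => by rw [← h] at h4; simp at h4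
    have hVD : V ≤ C * D := by linarith
    have hCpos : 0 < C := lt_of_le_of_ne hC fun h => by rw [← h] at hVD; linarith
    rw [le_div_iff₀ hV', inv_mul_le_iff₀ hCpos]
    exact hVD
  have hfin : ((6 / α) * ((T : ℝ) ^ 2 / pmin P + WG P π G γ / α))⁻¹ ≤ chainGap P π :=
    le_ciInf hbound
  have hCpos : 0 < (6 / α) * ((T : ℝ) ^ 2 / pmin P + WG P π G γ / α) := by
    have : (0:ℝ) < T := by exact_mod_cast hT
    positivity
  exact inv_le_of_inv_le₀ hCpos hfin

end ChainPaths
end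
end
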